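/- Let (u, b, p) be a smooth bounded solution of the stationary MHD/Hall–MHD system with parameter δ ∈ [0,1] on the slab ℝ²×𝕋 whose swirl components u^θ and b^θ are axisymmetric, and let Y(R) = ∫_{ℝ²×[0,1]} (|∇u|² + |∇b|²) φ_R dx. Then there exist constants C₁, C₂ > 0, independent of R, such that Y(R) ≤ C₁ Y'(R) + C₂ R^{1/2} (Y'(R))^{1/2} for all R ≥ 2. -/

import Mathlib

open MeasureTheory

noncomputable section

/-- Points of `ℝ³`. -/
abbrev V3 : Type := Fin 3 → ℝ

/-- Partial derivative `∂ᵢ f`. -/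
def pd (i : Fin 3) (f : V3 → ℝ) (x : V3) : ℝ := fderiv ℝ f x (Pi.single i 1)

/-- Componentwise Laplacian. -/
def lap (f : V3 → ℝ) (x : V3) : ℝ := ∑ i, pd i (pd i f) x

/-- Cross product in `ℝ³`. -/
def cross3 (a c : V3) : V3 :=
  ![a 1 * c 2 - a 2 * c 1, a 2 * c 0 - a 0 * c 2, a 0 * c 1 - a 1 * c 0]

/-- Curl of a vector field. -/
def curl (b : V3 → V3) (x : V3) : V3 :=
  ![pd 1 (fun y => b y 2) x - pd 2 (fun y => b y 1) x,
    pd 2 (fun y => b y 0) x - pd 0 (fun y => b y 2) x,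
    pd 0 (fun y => b y 1) x - pd 1 (fun y => b y 0) x]

/-- Euclidean dot product in `ℝ³`. -/
def dot3 (a c : V3) : ℝ := ∑ i, a i * c i

/-- `|x'| = √(x₁² + x₂²)`. -/
def nr (x : V3) : ℝ := Real.sqrt ((x 0) ^ 2 + (x 1) ^ 2)

/-- The slab `ℝ² × [0,1]`. -/
def slab : Set V3 := {x | 0 ≤ x 2 ∧ x 2 ≤ 1}

/-- The region `{|x'| ≤ R} × [0,1]`. -/
def cylSet (R : ℝ) : Set V3 := {x | (0 ≤ x 2 ∧ x 2 ≤ 1) ∧ nr x ≤ R}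

/-- The annular region `O_R = {R-1 ≤ |x'| ≤ R} × [0,1]`. -/
def OR (R : ℝ) : Set V3 := {x | (0 ≤ x 2 ∧ x 2 ≤ 1) ∧ R - 1 ≤ nr x ∧ nr x ≤ R}

/-- The radial cut-off function `φ_R`. -/
def phiR (R : ℝ) (x : V3) : ℝ := min 1 (max 0 (R - nr x))

/-- `|∇u|² = Σ_{i,j} |∂ᵢ uʲ|²`. -/
def gradSq (u : V3 → V3) (x : V3) : ℝ := ∑ i, ∑ j, (pd i (fun y => u y j) x) ^ 2

/-- The `L²` norm of a scalar function on a set. -/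
def l2 (f : V3 → ℝ) (S : Set V3) : ℝ := Real.sqrt (∫ x in S, (f x) ^ 2)

/-- The radial component `u^r` as a function of `x`. -/
def ur (u : V3 → V3) (x : V3) : ℝ := (x 0 * u x 0 + x 1 * u x 1) / nr x

/-- The point with cylindrical coordinates `(r, θ, z)`. -/
def cylPt (r θ z : ℝ) : V3 := ![r * Real.cos θ, r * Real.sin θ, z]

/-- The radial component `u^r` in cylindrical coordinates. -/
def compR (u : V3 → V3) (r θ z : ℝ) : ℝ :=
  Real.cos θ * u (cylPt r θ z) 0 + Real.sin θ * u (cylPt r θ z) 1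

/-- The swirl component `u^θ` in cylindrical coordinates. -/
def compTheta (u : V3 → V3) (r θ z : ℝ) : ℝ :=
  -Real.sin θ * u (cylPt r θ z) 0 + Real.cos θ * u (cylPt r θ z) 1

/-- A cylindrical component is axisymmetric if it is independent of `θ`. -/
def AxiSym (f : ℝ → ℝ → ℝ → ℝ) : Prop := ∀ r θ₁ θ₂ z, f r θ₁ z = f r θ₂ z

/-- `1`-periodicity in the `x₃` variable. -/
def PeriodicZ (u : V3 → V3) : Prop := ∀ x : V3, u ![x 0, x 1, x 2 + 1] = u x

/-- Divergence-free vector field. -/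
def DivFree (u : V3 → V3) : Prop := ∀ x, ∑ i, pd i (fun y => u y i) x = 0

/-- Boundedness of a vector field. -/
def Bounded3 (u : V3 → V3) : Prop := ∃ M, ∀ x, ‖u x‖ ≤ M

/-- The stationary MHD (`δ = 0`) / Hall–MHD (`δ = 1`) system:
`(u·∇)u + ∇p − (b·∇)b − Δu = 0`,
`(u·∇)b − (b·∇)u − Δb = δ ∇×((∇×b)×b)`, `div u = div b = 0`. -/
def IsMHD (δ : ℝ) (u b : V3 → V3) (p : V3 → ℝ) : Prop :=
  (∀ x i, (∑ j, u x j * pd j (fun y => u y i) x) + pd i p x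
      - (∑ j, b x j * pd j (fun y => b y i) x) - lap (fun y => u y i) x = 0) ∧
  (∀ x i, (∑ j, u x j * pd j (fun y => b y i) x)
      - (∑ j, b x j * pd j (fun y => u y i) x) - lap (fun y => b y i) x
      = δ * curl (fun y => cross3 (curl b y) (b y)) x i) ∧
  DivFree u ∧ DivFree b

/-- Growth of the local Dirichlet integral: `∫_{{|x'|≤R}×[0,1]} |∇u|²+|∇b|² ≤ C R^α`. -/
def DirichletGrowth (u b : V3 → V3) : Prop :=
  ∃ C > (0:ℝ), ∃ α > (0:ℝ), ∀ R > (1:ℝ),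
    (∫ x in cylSet R, (gradSq u x + gradSq b x)) ≤ C * R ^ α

/-- Radial derivative `∂_r f = (x'/|x'|)·(∂₁f, ∂₂f)`. -/
def radD (f : V3 → ℝ) (x : V3) : ℝ := (x 0 / nr x) * pd 0 f x + (x 1 / nr x) * pd 1 f x

/-- The unit radial vector `(x'/|x'|, 0)`. -/
def er3 (x : V3) : V3 := ![x 0 / nr x, x 1 / nr x, 0]

/-- Squared Euclidean length of a vector of `ℝ³`. -/
def sq3 (v : V3) : ℝ := ∑ i, (v i) ^ 2

/-! ### Partial derivatives -/

/-- The vertical unit vector. -/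
abbrev e3 : V3 := Pi.single 2 1

theorem ContDiff.pd {f : V3 → ℝ} (hf : ContDiff ℝ (⊤ : ℕ∞) f) (i : Fin 3) :
    ContDiff ℝ (⊤ : ℕ∞) (pd i f) := by
  have h : ContDiff ℝ (⊤ : ℕ∞) (fderiv ℝ f) := hf.fderiv_right (by norm_cast)
  exact h.clm_apply contDiff_const

theorem ContDiff.differentiable_top {f : V3 → ℝ} (hf : ContDiff ℝ (⊤ : ℕ∞) f) :
    Differentiable ℝ f :=
  hf.differentiable (by simp)

theorem pd_add {f g : V3 → ℝ} (hf : ContDiff ℝ (⊤ : ℕ∞) f) (hg : ContDiff ℝ (⊤ : ℕ∞) g)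
    (i : Fin 3) (x : V3) : pd i (fun y => f y + g y) x = pd i f x + pd i g x := by
  unfold pd
  rw [fderiv_fun_add (hf.differentiable_top x) (hg.differentiable_top x)]
  rfl

theorem pd_sub {f g : V3 → ℝ} (hf : ContDiff ℝ (⊤ : ℕ∞) f) (hg : ContDiff ℝ (⊤ : ℕ∞) g)
    (i : Fin 3) (x : V3) : pd i (fun y => f y - g y) x = pd i f x - pd i g x := by
  unfold pd
  rw [fderiv_fun_sub (hf.differentiable_top x) (hg.differentiable_top x)]
  rfl

theorem pd_mul {f g : V3 → ℝ} (hf : ContDiff ℝ (⊤ : ℕ∞) f) (hg : ContDiff ℝ (⊤ : ℕ∞) g)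
    (i : Fin 3) (x : V3) : pd i (fun y => f y * g y) x = pd i f x * g x + f x * pd i g x := by
  unfold pd
  rw [fderiv_fun_mul (hf.differentiable_top x) (hg.differentiable_top x)]
  simp only [add_apply, smul_apply, smul_eq_mul]
  ring

theorem pd_const (c : ℝ) (i : Fin 3) (x : V3) : pd i (fun _ => c) x = 0 := by
  simp [pd]

theorem pd_coord (i j : Fin 3) (x : V3) : pd i (fun y => y j) x = if i = j then 1 else 0 := by
  unfold pd
  have : HasFDerivAt (fun y : V3 => y j)
      (ContinuousLinearMap.proj (R := ℝ) (φ := fun _ : Fin 3 => ℝ) j) x :=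
    (ContinuousLinearMap.proj (R := ℝ) (φ := fun _ : Fin 3 => ℝ) j).hasFDerivAt
  rw [this.fderiv]
  simp [Pi.single_apply, eq_comm]

theorem pd_comp {h : ℝ → ℝ} {f : V3 → ℝ} (hh : Differentiable ℝ h)
    (hf : ContDiff ℝ (⊤ : ℕ∞) f) (i : Fin 3) (x : V3) :
    pd i (fun y => h (f y)) x = deriv h (f x) * pd i f x := by
  unfold pd
  have := (hh (f x)).hasDerivAt.comp_hasFDerivAt x (hf.differentiable_top x).hasFDerivAt
  have h2 := this.fderiv
  simp only [Function.comp_def] at h2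
  rw [h2]
  simp

theorem pd_shift (f : V3 → ℝ) (v : V3) (i : Fin 3) (x : V3) :
    pd i (fun y => f (y + v)) x = pd i f (x + v) := by
  unfold pd
  rw [fderiv_comp_add_right]

theorem pd_periodic {f : V3 → ℝ} {v : V3} (hf : ∀ x, f (x + v) = f x) (i : Fin 3) (x : V3) :
    pd i f (x + v) = pd i f x := by
  rw [← pd_shift, show (fun y => f (y + v)) = f from funext hf]

/-- A smooth function all of whose partial derivatives vanish is constant. -/
theorem eq_of_pd_eq_zero {f : V3 → ℝ} (hf : ContDiff ℝ (⊤ : ℕ∞) f)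
    (h : ∀ i x, pd i f x = 0) (x y : V3) : f x = f y := by
  refine is_const_of_fderiv_eq_zero hf.differentiable_top (fun z => ?_) x y
  ext v
  have hv : v = ∑ i, v i • (Pi.single i 1 : V3) := by
    ext j
    simp [Finset.sum_apply, Pi.single_apply]
  rw [hv, map_sum]
  refine Finset.sum_eq_zero fun i _ => ?_
  have := h i z
  unfold pd at this
  simp [this]

/-! ### Geometry of the slab -/

/-- The box `[-R,R]² × [0,1]`. -/
def box (R : ℝ) : Set V3 := Set.Icc ![-R, -R, 0] ![R, R, 1]

theorem mem_box {R : ℝ} {x : V3} :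
    x ∈ box R ↔ |x 0| ≤ R ∧ |x 1| ≤ R ∧ 0 ≤ x 2 ∧ x 2 ≤ 1 := by
  simp only [box, Set.mem_Icc, Pi.le_def, Fin.forall_fin_succ, abs_le]
  simp
  tauto

theorem isCompact_box (R : ℝ) : IsCompact (box R) := isCompact_Icc

theorem measurableSet_box (R : ℝ) : MeasurableSet (box R) := measurableSet_Icc

theorem continuous_nr : Continuous nr := by
  unfold nr; fun_prop

theorem abs_le_nr (x : V3) : |x 0| ≤ nr x ∧ |x 1| ≤ nr x := by
  constructor <;> (unfold nr; apply Real.abs_le_sqrt; nlinarith [sq_nonneg (x 0), sq_nonneg (x 1)])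

theorem nr_nonneg (x : V3) : 0 ≤ nr x := Real.sqrt_nonneg _

theorem sq_nr (x : V3) : nr x ^ 2 = x 0 ^ 2 + x 1 ^ 2 := Real.sq_sqrt (by positivity)

theorem measurableSet_slab : MeasurableSet slab := by
  apply IsClosed.measurableSet
  exact (isClosed_le continuous_const (continuous_apply 2)).inter
    (isClosed_le (continuous_apply 2) continuous_const)

theorem box_subset_slab (R : ℝ) : box R ⊆ slab := fun _ hx => (mem_box.1 hx).2.2

theorem setIntegral_slab_eq_box {R : ℝ} {f : V3 → ℝ} (hf : ∀ x, R < nr x → f x = 0) :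
    ∫ x in slab, f x = ∫ x in box R, f x := by
  refine (setIntegral_eq_of_subset_of_forall_sdiff_eq_zero measurableSet_slab
    (box_subset_slab R) fun x hx => hf x ?_)
  by_contra! h
  exact hx.2 (mem_box.2 ⟨(abs_le_nr x).1.trans h, (abs_le_nr x).2.trans h, hx.1.1, hx.1.2⟩)

theorem measurableSet_OR (R : ℝ) : MeasurableSet (OR R) := by
  apply IsClosed.measurableSet
  exact ((isClosed_le continuous_const (continuous_apply 2)).inter
    (isClosed_le (continuous_apply 2) continuous_const)).inter
    ((isClosed_le continuous_const continuous_nr).inter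
    (isClosed_le continuous_nr continuous_const))

theorem OR_subset_box (R : ℝ) : OR R ⊆ box R := fun x hx =>
  mem_box.2 ⟨(abs_le_nr x).1.trans hx.2.2, (abs_le_nr x).2.trans hx.2.2, hx.1.1, hx.1.2⟩

theorem Continuous.integrableOn_box {f : V3 → ℝ} (hf : Continuous f) (R : ℝ) :
    IntegrableOn f (box R) :=
  hf.continuousOn.integrableOn_compact (isCompact_box R)

theorem Continuous.integrableOn_OR {f : V3 → ℝ} (hf : Continuous f) (R : ℝ) :
    IntegrableOn f (OR R) :=
  (hf.integrableOn_box R).mono_set (OR_subset_box R)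

/-- Functions supported in the annular region are controlled by integrals over it. -/
theorem abs_setIntegral_box_le {R : ℝ} {f g : V3 → ℝ}
    (hf : ∀ x, ¬ (R - 1 ≤ nr x ∧ nr x ≤ R) → f x = 0)
    (hfg : ∀ x ∈ OR R, |f x| ≤ g x) (hg : Continuous g) :
    |∫ x in box R, f x| ≤ ∫ x in OR R, g x := by
  have h1 : ∫ x in box R, f x = ∫ x in OR R, f x := by
    refine setIntegral_eq_of_subset_of_forall_sdiff_eq_zero (measurableSet_box R)
      (OR_subset_box R) fun x hx => hf x fun h => hx.2 ⟨box_subset_slab R hx.1, h⟩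
  rw [h1, ← Real.norm_eq_abs]
  refine norm_integral_le_of_norm_le (hg.integrableOn_OR R) ?_
  exact (ae_restrict_iff' (measurableSet_OR R)).2 (Filter.Eventually.of_forall hfg)

/-- Divergence theorem for smooth vector fields which are periodic in the vertical variable and
compactly supported in the horizontal variables. -/
theorem integral_box_div_eq_zero {R : ℝ} (hR : 0 < R) {G : Fin 3 → V3 → ℝ}
    (hG : ∀ i, ContDiff ℝ (⊤ : ℕ∞) (G i)) (hper : ∀ x, G 2 (x + e3) = G 2 x)
    (hsupp : ∀ i x, R ≤ nr x → G i x = 0) :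
    ∫ x in box R, ∑ i, pd i (G i) x = 0 := by
  have hle : (![-R, -R, 0] : V3) ≤ ![R, R, 1] := by
    intro i; fin_cases i <;> simp <;> linarith
  have key := integral_divergence_of_hasFDerivAt_off_countable' (![-R, -R, 0] : V3) ![R, R, 1] hle
    G (fun i x => fderiv ℝ (G i) x) ∅ Set.countable_empty (fun i => (hG i).continuous.continuousOn)
    (fun x _ i => ((hG i).differentiable_top x).hasFDerivAt)
    (Continuous.integrableOn_box (continuous_finsetSum _ fun i _ => ((hG i).pd i).continuous) R)
  have hbd : ∀ x : V3, |x 0| = R ∨ |x 1| = R → R ≤ nr x := by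
    rintro x (h | h)
    · rw [← h]; exact (abs_le_nr x).1
    · rw [← h]; exact (abs_le_nr x).2
  unfold box pd
  rw [key, Fin.sum_univ_three]
  have h0 : ∀ (s : ℝ) (y : Fin 2 → ℝ), |s| = R → G 0 (Fin.insertNth 0 s y) = 0 := fun s y h =>
    hsupp _ _ (hbd _ (Or.inl (by simpa using h)))
  have h1 : ∀ (s : ℝ) (y : Fin 2 → ℝ), |s| = R → G 1 (Fin.insertNth 1 s y) = 0 := fun s y h =>
    hsupp _ _ (hbd _ (Or.inr (by rw [Fin.insertNth_apply_same]; exact h)))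
  have h2 : ∀ y : Fin 2 → ℝ, G 2 (Fin.insertNth 2 1 y) = G 2 (Fin.insertNth 2 0 y) := by
    intro y
    rw [← hper (Fin.insertNth 2 0 y)]
    congr 1
    ext i
    refine Fin.succAboveCases 2 ?_ (fun j => ?_) i
    · simp
    · simp
  have hRabs : |R| = R := abs_of_pos hR
  have hRabs' : |-R| = R := by rw [abs_neg, hRabs]
  simp only [Matrix.cons_val, h0 _ _ hRabs, h0 _ _ hRabs', h1 _ _ hRabs, h1 _ _ hRabs', h2,
    integral_zero, sub_self, add_zero]

/-! ### Slicing the slab -/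

/-- The point of `ℝ³` with horizontal part `y` and height `z`. -/
def pt (y : Fin 2 → ℝ) (z : ℝ) : V3 := ![y 0, y 1, z]

theorem insertNth_two_eq_pt (y : Fin 2 → ℝ) (z : ℝ) : (Fin.insertNth 2 z y : V3) = pt y z := by
  ext i
  fin_cases i
  · exact Fin.insertNth_apply_succAbove (α := fun _ => ℝ) (2 : Fin 3) z y 0
  · exact Fin.insertNth_apply_succAbove (α := fun _ => ℝ) (2 : Fin 3) z y 1
  · exact Fin.insertNth_apply_same (α := fun _ => ℝ) (2 : Fin 3) z y

theorem pt_add_smul_e3 (y : Fin 2 → ℝ) (z t : ℝ) : pt y z + t • e3 = pt y (z + t) := by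
  ext i; fin_cases i <;> simp [pt]

theorem continuous_pt : Continuous fun q : (Fin 2 → ℝ) × ℝ => pt q.1 q.2 := by
  unfold pt
  refine continuous_pi fun i => ?_
  fin_cases i <;> simp <;> fun_prop

theorem continuous_pt_right (y : Fin 2 → ℝ) : Continuous (pt y) :=
  continuous_pt.comp (by fun_prop : Continuous fun z : ℝ => (y, z))

theorem nr_add_smul_e3 (x : V3) (t : ℝ) : nr (x + t • e3) = nr x := by
  simp [nr]

theorem setIntegral_box_eq_slices {R : ℝ} {f : V3 → ℝ} (hf : IntegrableOn f (box R)) :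
    ∫ x in box R, f x =
      ∫ y in Set.Icc ![-R, -R] ![R, R], ∫ z in (0:ℝ)..1, f (pt y z) := by
  have mp := (volume_preserving_piFinSuccAbove (fun _ : Fin 3 => ℝ) 2).symm
  have hpre : (MeasurableEquiv.piFinSuccAbove (fun _ : Fin 3 => ℝ) 2).symm ⁻¹' (box R)
      = Set.Icc (0:ℝ) 1 ×ˢ Set.Icc ![-R, -R] ![R, R] := by
    ext ⟨z, y⟩
    change Fin.insertNth 2 z y ∈ box R ↔ _
    rw [insertNth_two_eq_pt, mem_box]
    simp [pt, Pi.le_def, Fin.forall_fin_two, abs_le]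
    tauto
  have hme := (MeasurableEquiv.piFinSuccAbove (fun _ : Fin 3 => ℝ) 2).symm.measurableEmbedding
  have h1 := mp.setIntegral_preimage_emb hme f (box R)
  have h2 := (mp.integrableOn_comp_preimage hme (f := f) (s := box R)).2 hf
  rw [hpre] at h1 h2
  rw [← h1]
  have h3 := setIntegral_prod_swap (Set.Icc (0:ℝ) 1) (Set.Icc ![-R, -R] ![R, R])
    (fun q => f ((MeasurableEquiv.piFinSuccAbove (fun _ : Fin 3 => ℝ) 2).symm q))
    (μ := volume) (ν := volume)
  have h4 := h2.swap
  erw [← h3, setIntegral_prod _ h4]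
  refine setIntegral_congr_fun measurableSet_Icc fun y _ => ?_
  rw [intervalIntegral.integral_of_le zero_le_one, integral_Icc_eq_integral_Ioc]
  refine setIntegral_congr_fun measurableSet_Ioc fun z _ => ?_
  change f (Fin.insertNth 2 z y) = _
  rw [insertNth_two_eq_pt]

theorem volume_setOf_mem {S : Set ℂ} {T : Set ℝ} (hS : MeasurableSet S) (hT : MeasurableSet T) :
    volume {x : V3 | (⟨x 0, x 1⟩ : ℂ) ∈ S ∧ x 2 ∈ T} = volume T * volume S := by
  have mp := (volume_preserving_piFinSuccAbove (fun _ : Fin 3 => ℝ) 2)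
  have mc := Complex.volume_preserving_equiv_pi
  have hS' : volume (Complex.measurableEquivPi.symm ⁻¹' S) = volume S :=
    mc.symm.measure_preimage hS.nullMeasurableSet
  rw [← hS', ← Measure.prod_prod, ← Measure.volume_eq_prod,
    ← mp.measure_preimage
      (hT.prod (Complex.measurableEquivPi.symm.measurable hS)).nullMeasurableSet]
  congr 1
  ext x
  have hx : Complex.measurableEquivPi.symm
      ((MeasurableEquiv.piFinSuccAbove (fun _ : Fin 3 => ℝ) 2) x).2 = ⟨x 0, x 1⟩ := by
    rw [Complex.measurableEquivPi_symm_apply]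
    apply Complex.ext <;> simp <;> rfl
  simp only [Set.mem_ofPred_eq, Set.mem_preimage, Set.mem_prod, hx]
  rw [and_comm]
  rfl

theorem norm_mk_eq_nr (x : V3) : ‖(⟨x 0, x 1⟩ : ℂ)‖ = nr x := by
  rw [Complex.norm_eq_sqrt_sq_add_sq, nr]

theorem volume_OR {R : ℝ} (hR : 1 ≤ R) : volume.real (OR R) ≤ 2 * Real.pi * R := by
  have h : OR R = {x : V3 | (⟨x 0, x 1⟩ : ℂ) ∈ Metric.closedBall (0:ℂ) R \ Metric.ball 0 (R - 1)
      ∧ x 2 ∈ Set.Icc (0:ℝ) 1} := by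
    ext x
    simp [OR, norm_mk_eq_nr]
    tauto
  have hV : volume.real (Metric.closedBall (0:ℂ) R \ Metric.ball 0 (R - 1)) =
      R ^ 2 * Real.pi - (R - 1) ^ 2 * Real.pi := by
    rw [measureReal_sdiff ?_ measurableSet_ball measure_closedBall_lt_top.ne]
    · have h1 : (0:ℝ) ≤ R - 1 := by linarith
      have h2 : (0:ℝ) ≤ R := by linarith
      simp [Measure.real, Complex.volume_closedBall, Complex.volume_ball, h1, h2]
    · exact Metric.ball_subset_closedBall.trans (Metric.closedBall_subset_closedBall (by linarith))
  rw [h, Measure.real, volume_setOf_mem (measurableSet_closedBall.diff measurableSet_ball)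
    measurableSet_Icc, ENNReal.toReal_mul]
  change _ * volume.real _ ≤ _
  rw [hV]
  simp
  nlinarith [Real.pi_pos]

theorem le_volume_cylSet {R : ℝ} (hR : 0 ≤ R) : R ^ 2 ≤ volume.real (cylSet R) := by
  have h : cylSet R = {x : V3 | (⟨x 0, x 1⟩ : ℂ) ∈ Metric.closedBall (0:ℂ) R
      ∧ x 2 ∈ Set.Icc (0:ℝ) 1} := by
    ext x
    simp [cylSet, norm_mk_eq_nr]
    tauto
  rw [h, Measure.real, volume_setOf_mem measurableSet_closedBall measurableSet_Icc]
  simp [Complex.volume_closedBall, hR]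
  nlinarith [Real.pi_gt_three, sq_nonneg R]

theorem volume_nr_eq (R : ℝ) : volume {x : V3 | nr x = R} = 0 := by
  have h : {x : V3 | nr x = R} = {x : V3 | (⟨x 0, x 1⟩ : ℂ) ∈ Metric.sphere (0:ℂ) R
      ∧ x 2 ∈ Set.univ} := by
    ext x
    simp [norm_mk_eq_nr]
  rw [h, volume_setOf_mem Metric.isClosed_sphere.measurableSet MeasurableSet.univ]
  simp [Measure.addHaar_sphere]

theorem setIntegral_OR_shift {g : V3 → ℝ} (hg : Continuous g) (hper : ∀ x, g (x + e3) = g x)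
    (R t : ℝ) : ∫ x in OR R, g (x + t • e3) = ∫ x in OR R, g x := by
  set A : Set V3 := {x | R - 1 ≤ nr x ∧ nr x ≤ R} with hA
  have hAm : MeasurableSet A := ((isClosed_le continuous_const continuous_nr).inter
    (isClosed_le continuous_nr continuous_const)).measurableSet
  have hOR : OR R = box R ∩ A := by
    ext x
    exact ⟨fun h => ⟨OR_subset_box R h, h.2⟩, fun h => ⟨box_subset_slab R h.1, h.2⟩⟩
  have hg' : Continuous fun x => g (x + t • e3) := hg.comp (by fun_prop)
  rw [hOR, ← setIntegral_indicator hAm, ← setIntegral_indicator hAm,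
    setIntegral_box_eq_slices ((hg.integrableOn_box R).indicator hAm),
    setIntegral_box_eq_slices ((hg'.integrableOn_box R).indicator hAm)]
  refine setIntegral_congr_fun measurableSet_Icc fun y _ => ?_
  have hp : Function.Periodic (fun z => A.indicator g (pt y z)) 1 := by
    intro z
    have h := pt_add_smul_e3 y z 1
    rw [one_smul] at h
    have hA' : pt y z + e3 ∈ A ↔ pt y z ∈ A := by
      have := nr_add_smul_e3 (pt y z) 1
      rw [one_smul] at this
      simp [hA, this]
    simp only [← h, Set.indicator_apply, hA', hper]
  have e1 : ∀ z, A.indicator (fun x => g (x + t • e3)) (pt y z) = A.indicator g (pt y (z + t)) := by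
    intro z
    have hA' : pt y z + t • e3 ∈ A ↔ pt y z ∈ A := by simp [hA, nr_add_smul_e3]
    simp only [← pt_add_smul_e3, Set.indicator_apply, hA']
  simp only [e1]
  have h1 := intervalIntegral.integral_comp_add_right (a := 0) (b := 1)
    (fun z => A.indicator g (pt y z)) t
  have h2 := hp.intervalIntegral_add_eq t 0
  simp only [zero_add] at h1 h2
  rw [h1, add_comm, h2]

theorem hasDerivAt_pd {f : V3 → ℝ} (hf : ContDiff ℝ (⊤ : ℕ∞) f) {c : ℝ → V3} {c' : V3} {t : ℝ}
    (hc : HasDerivAt c c' t) :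
    HasDerivAt (fun s => f (c s)) (∑ i, c' i * pd i f (c t)) t := by
  have h := (hf.differentiable_top (c t)).hasFDerivAt.comp_hasDerivAt t hc
  convert! h using 1
  have hv : c' = ∑ i, c' i • (Pi.single i 1 : V3) := by
    ext j
    simp [Finset.sum_apply, Pi.single_apply]
  conv_rhs => rw [hv, map_sum]
  simp [pd]

theorem hasDerivAt_pt (y : Fin 2 → ℝ) (z : ℝ) : HasDerivAt (pt y) e3 z := by
  rw [hasDerivAt_pi]
  intro i
  fin_cases i
  · simpa [pt] using hasDerivAt_const z (y 0)
  · simpa [pt] using hasDerivAt_const z (y 1)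
  · simpa [pt] using hasDerivAt_id' z

theorem hasDerivAt_comp_pt {f : V3 → ℝ} (hf : ContDiff ℝ (⊤ : ℕ∞) f) (y : Fin 2 → ℝ) (z : ℝ) :
    HasDerivAt (fun s => f (pt y s)) (pd 2 f (pt y z)) z := by
  have h := hasDerivAt_pd hf (hasDerivAt_pt y z)
  simpa [Pi.single_apply] using h

/-- If `F` has vanishing vertical means, then the pairing of `F` with a vertically periodic
function is controlled by its pairings with translates of the vertical derivative. -/
theorem abs_integral_mul_le_of_mean_zero {R B : ℝ} {F g : V3 → ℝ} (hF : Continuous F)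
    (hg : ContDiff ℝ (⊤ : ℕ∞) g) (hper : ∀ x, g (x + e3) = g x)
    (hmean : ∀ y, ∫ z in (0:ℝ)..1, F (pt y z) = 0)
    (hB : ∀ t : ℝ, |∫ x in box R, F x * pd 2 g (x + t • e3)| ≤ B) :
    |∫ x in box R, F x * g x| ≤ B := by
  have hgc := hg.continuous
  have hg2 := (hg.pd 2).continuous
  have hshift : Continuous fun q : V3 × ℝ => q.1 + q.2 • e3 := by fun_prop
  set k : V3 → ℝ → ℝ := fun x t => F x * ((1 - t) * pd 2 g (x + t • e3)) with hk
  have hkc : Continuous (Function.uncurry k) := by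
    have := hg2.comp hshift
    have h1 : Continuous fun q : V3 × ℝ => F q.1 := hF.comp continuous_fst
    exact h1.mul ((continuous_const.sub continuous_snd).mul this)
  have hy : ∀ y z, F (pt y z) * g (pt y z) =
      F (pt y z) * (∫ t in (0:ℝ)..1, g (pt y t)) - ∫ t in (0:ℝ)..1, k (pt y z) t := by
    intro y z
    have hG : ∀ t ∈ Set.uIcc (0:ℝ) 1,
        HasDerivAt (fun t => g (pt y (z + t))) (pd 2 g (pt y (z + t))) t := fun t _ =>
      (hasDerivAt_comp_pt hg y (z + t)).comp_const_add z t
    have hc : Continuous fun t => pd 2 g (pt y (z + t)) :=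
      hg2.comp ((continuous_pt_right y).comp (continuous_const.add continuous_id))
    have hl : ∀ t ∈ Set.uIcc (0:ℝ) 1, HasDerivAt (fun t : ℝ => 1 - t) (-1) t := fun t _ => by
      simpa using (hasDerivAt_id t).const_sub 1
    have ibp := intervalIntegral.integral_mul_deriv_eq_deriv_mul hl hG
      (continuous_const.intervalIntegrable _ _) (hc.intervalIntegrable _ _)
    have hp : Function.Periodic (fun s => g (pt y s)) 1 := by
      intro s
      have h := pt_add_smul_e3 y s 1
      rw [one_smul] at h
      simp only [← h, hper]
    have h1 : ∫ t in (0:ℝ)..1, g (pt y (z + t)) = ∫ t in (0:ℝ)..1, g (pt y t) := by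
      have h2 := hp.intervalIntegral_add_eq z 0
      have h3 := intervalIntegral.integral_comp_add_left (a := 0) (b := 1) (fun s => g (pt y s)) z
      simp only [zero_add, add_zero] at h2 h3
      rw [h3, h2]
    simp only [hk, intervalIntegral.integral_const_mul, pt_add_smul_e3]
    rw [ibp, ← h1]
    simp
    ring
  have hkint : Continuous fun x => ∫ t in (0:ℝ)..1, k x t :=
    intervalIntegral.continuous_parametric_intervalIntegral_of_continuous' hkc 0 1
  have hsplit : ∫ x in box R, F x * g x = - ∫ x in box R, ∫ t in (0:ℝ)..1, k x t := by
    rw [setIntegral_box_eq_slices (f := fun x => F x * g x) ((hF.mul hgc).integrableOn_box R),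
      setIntegral_box_eq_slices (hkint.integrableOn_box R), ← integral_neg]
    refine setIntegral_congr_fun measurableSet_Icc fun y _ => ?_
    simp only [hy]
    rw [intervalIntegral.integral_sub, intervalIntegral.integral_mul_const, hmean]
    · simp
    · exact ((hF.comp (continuous_pt_right y)).mul continuous_const).intervalIntegrable _ _
    · exact (hkint.comp (continuous_pt_right y)).intervalIntegrable _ _
  have hswap : ∫ x in box R, ∫ t in (0:ℝ)..1, k x t = ∫ t in (0:ℝ)..1, ∫ x in box R, k x t := by
    simp only [intervalIntegral.integral_of_le zero_le_one]
    refine integral_integral_swap ?_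
    rw [Measure.prod_restrict]
    refine IntegrableOn.mono_set (t := box R ×ˢ Set.Icc (0:ℝ) 1) ?_
      (Set.prod_mono_right Set.Ioc_subset_Icc_self)
    exact hkc.continuousOn.integrableOn_compact ((isCompact_box R).prod isCompact_Icc)
  rw [hsplit, abs_neg, hswap]
  have hb := intervalIntegral.norm_integral_le_of_norm_le_const (a := 0) (b := 1) (C := B)
    (f := fun t => ∫ x in box R, k x t) ?_
  · simpa using hb
  · intro t ht
    rw [Set.uIoc_of_le zero_le_one] at ht
    have e : ∫ x in box R, k x t = (1 - t) * ∫ x in box R, F x * pd 2 g (x + t • e3) := by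
      rw [← integral_const_mul]
      congr 1; ext x; simp only [hk]; ring
    rw [e, Real.norm_eq_abs, abs_mul, abs_of_nonneg (by linarith [ht.2] : (0:ℝ) ≤ 1 - t)]
    nlinarith [hB t, abs_nonneg (∫ x in box R, F x * pd 2 g (x + t • e3)), ht.1, ht.2]

/-! ### The radial component has vanishing vertical means -/

theorem hasDerivAt_cylPt_radius (r θ z : ℝ) :
    HasDerivAt (fun s => cylPt s θ z) ![Real.cos θ, Real.sin θ, 0] r := by
  rw [hasDerivAt_pi]
  intro i
  fin_cases i
  · simpa [cylPt] using (hasDerivAt_id' r).mul_const (Real.cos θ)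
  · simpa [cylPt] using (hasDerivAt_id' r).mul_const (Real.sin θ)
  · simpa [cylPt] using hasDerivAt_const r z

theorem hasDerivAt_cylPt_angle (r θ z : ℝ) :
    HasDerivAt (fun s => cylPt r s z) ![-(r * Real.sin θ), r * Real.cos θ, 0] θ := by
  rw [hasDerivAt_pi]
  intro i
  fin_cases i
  · simpa [cylPt] using (Real.hasDerivAt_cos θ).const_mul r
  · simpa [cylPt] using (Real.hasDerivAt_sin θ).const_mul r
  · simpa [cylPt] using hasDerivAt_const θ z

theorem hasDerivAt_radius_mul_compR {u : V3 → V3}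
    (hu : ∀ i, ContDiff ℝ (⊤ : ℕ∞) fun x => u x i) (hdiv : DivFree u)
    (hax : AxiSym (compTheta u)) (r θ z : ℝ) :
    HasDerivAt (fun s => s * compR u s θ z)
      (-(r * pd 2 (fun x => u x 2) (cylPt r θ z))) r := by
  have h0 := hasDerivAt_pd (hu 0) (hasDerivAt_cylPt_radius r θ z)
  have h1 := hasDerivAt_pd (hu 1) (hasDerivAt_cylPt_radius r θ z)
  have g0 := hasDerivAt_pd (hu 0) (hasDerivAt_cylPt_angle r θ z)
  have g1 := hasDerivAt_pd (hu 1) (hasDerivAt_cylPt_angle r θ z)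
  have hR := (hasDerivAt_id' r).mul ((h0.const_mul (Real.cos θ)).add (h1.const_mul (Real.sin θ)))
  have hT := ((Real.hasDerivAt_sin θ).neg.mul g0).add ((Real.hasDerivAt_cos θ).mul g1)
  have hconst : HasDerivAt (fun s => compTheta u r s z) 0 θ := by
    have : (fun s => compTheta u r s z) = fun _ => compTheta u r θ z :=
      funext fun s => hax r s θ z
    rw [this]
    exact hasDerivAt_const _ _
  have hT0 := hT.unique hconst
  have hd := hdiv (cylPt r θ z)
  refine hR.congr_deriv ?_
  simp only [Fin.sum_univ_three, Matrix.cons_val, Pi.add_apply, Pi.neg_apply] at hT0 hd ⊢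
  linear_combination r * hd - hT0 + (r * pd 0 (fun x => u x 0) (cylPt r θ z) +
    r * pd 1 (fun x => u x 1) (cylPt r θ z)) * Real.sin_sq_add_cos_sq θ

theorem radial_mean_eq_zero {u : V3 → V3} (hu : ∀ i, ContDiff ℝ (⊤ : ℕ∞) fun x => u x i)
    (hdiv : DivFree u) (hper : ∀ x, u (x + e3) = u x) (hax : AxiSym (compTheta u))
    (y : Fin 2 → ℝ) :
    ∫ z in (0:ℝ)..1, (y 0 * u (pt y z) 0 + y 1 * u (pt y z) 1) = 0 := by
  set w : ℂ := ⟨y 0, y 1⟩ with hw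
  set r := ‖w‖
  set θ := w.arg
  have e0 : r * Real.cos θ = y 0 := Complex.norm_mul_cos_arg w
  have e1 : r * Real.sin θ = y 1 := Complex.norm_mul_sin_arg w
  have hpt : ∀ z, cylPt r θ z = pt y z := by
    intro z
    simp only [cylPt, pt, e0, e1]
  set k : ℝ → ℝ → ℝ := fun s z => -(s * pd 2 (fun x => u x 2) (cylPt s θ z)) with hk
  have hcyl : Continuous fun q : ℝ × ℝ => cylPt q.1 θ q.2 := by
    unfold cylPt
    refine continuous_pi fun i => ?_
    fin_cases i <;> simp <;> fun_prop
  have hkc : Continuous (Function.uncurry k) :=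
    (continuous_fst.mul (((hu 2).pd 2).continuous.comp hcyl)).neg
  have hrad : ∀ z, y 0 * u (pt y z) 0 + y 1 * u (pt y z) 1 = ∫ s in (0:ℝ)..r, k s z := by
    intro z
    have hkz : Continuous fun s => k s z := hkc.comp (by fun_prop : Continuous fun s : ℝ => (s, z))
    rw [intervalIntegral.integral_eq_sub_of_hasDerivAt
      (fun s _ => hasDerivAt_radius_mul_compR hu hdiv hax s θ z) (hkz.intervalIntegrable _ _)]
    simp only [compR, hpt, zero_mul, sub_zero]
    rw [← e0, ← e1]
    ring
  simp only [hrad]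
  rw [intervalIntegral_intervalIntegral_swap]
  · have hin : ∀ s, ∫ z in (0:ℝ)..1, k s z = 0 := by
      intro s
      have hc : ∀ z, cylPt s θ z = pt ![s * Real.cos θ, s * Real.sin θ] z := fun z => by
        simp [cylPt, pt]
      simp only [hk, intervalIntegral.integral_neg, intervalIntegral.integral_const_mul, hc]
      rw [intervalIntegral.integral_eq_sub_of_hasDerivAt
        (fun z _ => hasDerivAt_comp_pt (hu 2) _ z)
        ((((hu 2).pd 2).continuous.comp (continuous_pt_right _)).intervalIntegrable _ _)]
      have h := pt_add_smul_e3 ![s * Real.cos θ, s * Real.sin θ] 0 1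
      rw [one_smul, zero_add] at h
      simp [← h, hper]
    simp [hin]
  · refine IntegrableOn.mono_set (t := Set.uIcc 0 1 ×ˢ Set.uIcc 0 r) ?_
      (Set.prod_mono Set.uIoc_subset_uIcc Set.uIoc_subset_uIcc)
    exact (hkc.comp continuous_swap).continuousOn.integrableOn_compact
      (isCompact_uIcc.prod isCompact_uIcc)

/-! ### The derivative of the truncated Dirichlet integral -/

theorem phiR_of_le {R : ℝ} {x : V3} (h : nr x ≤ R - 1) : phiR R x = 1 := by
  unfold phiR
  rw [max_eq_right (by linarith), min_eq_left (by linarith)]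

theorem phiR_of_ge {R : ℝ} {x : V3} (h : R ≤ nr x) : phiR R x = 0 := by
  unfold phiR
  rw [max_eq_left (by linarith), min_eq_right zero_le_one]

theorem phiR_of_mem {R : ℝ} {x : V3} (h1 : R - 1 ≤ nr x) (h2 : nr x ≤ R) :
    phiR R x = R - nr x := by
  unfold phiR
  rw [max_eq_right (by linarith), min_eq_right (by linarith)]

theorem continuous_phiR (R : ℝ) : Continuous (phiR R) :=
  continuous_const.min (continuous_const.max (continuous_const.sub continuous_nr))

theorem abs_phiR_sub_le (R S : ℝ) (x : V3) : |phiR R x - phiR S x| ≤ |R - S| := by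
  unfold phiR
  refine (abs_min_sub_min_le_max _ _ _ _).trans (max_le (by simp) ?_)
  refine (abs_max_sub_max_le_max _ _ _ _).trans (max_le (by simp) ?_)
  simp

theorem hasDerivAt_phiR {R : ℝ} {x : V3} (h1 : nr x ≠ R - 1) (h2 : nr x ≠ R) :
    HasDerivAt (fun S => phiR S x) ((OR R).indicator 1 x) R ∨ x ∉ slab := by
  by_cases hx : x ∈ slab
  · left
    rcases lt_or_gt_of_ne h1 with h | h
    · have : x ∉ OR R := fun hx' => absurd hx'.2.1 (not_le.2 h)
      rw [Set.indicator_of_notMem this]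
      refine (hasDerivAt_const R (1:ℝ)).congr_of_eventuallyEq ?_
      filter_upwards [lt_mem_nhds (show nr x + 1 < R by linarith)] with S hS
      exact phiR_of_le (by linarith)
    rcases lt_or_gt_of_ne h2 with h' | h'
    · have : x ∈ OR R := ⟨hx, h.le, h'.le⟩
      rw [Set.indicator_of_mem this]
      refine ((hasDerivAt_id' R).sub_const (nr x)).congr_of_eventuallyEq ?_
      filter_upwards [lt_mem_nhds h', gt_mem_nhds (show R < nr x + 1 by linarith)] with S hS hS'
      exact phiR_of_mem (by linarith) hS.le
    · have : x ∉ OR R := fun hx' => absurd hx'.2.2 (not_le.2 h')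
      rw [Set.indicator_of_notMem this]
      refine (hasDerivAt_const R (0:ℝ)).congr_of_eventuallyEq ?_
      filter_upwards [gt_mem_nhds h'] with S hS
      exact phiR_of_ge hS.le
  · exact Or.inr hx

theorem deriv_integral_mul_phiR {D : V3 → ℝ} (hD : Continuous D) (R : ℝ) :
    deriv (fun S => ∫ x in slab, D x * phiR S x) R = ∫ x in OR R, D x := by
  have hloc : ∀ S < R + 1, ∫ x in slab, D x * phiR S x = ∫ x in box (R + 1), D x * phiR S x :=
    fun S hS => setIntegral_slab_eq_box fun x hx => by
      rw [phiR_of_ge (hS.trans hx).le, mul_zero]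
  have hev : (fun S => ∫ x in slab, D x * phiR S x) =ᶠ[nhds R]
      fun S => ∫ x in box (R + 1), D x * phiR S x := by
    filter_upwards [gt_mem_nhds (show R < R + 1 by linarith)] with S hS using hloc S hS
  rw [hev.deriv_eq]
  have hmain := hasDerivAt_integral_of_dominated_loc_of_lip (𝕜 := ℝ)
    (μ := volume.restrict (box (R + 1))) (F := fun S x => D x * phiR S x)
    (F' := (OR R).indicator D) (bound := fun x => |D x|) (x₀ := R) (s := Set.univ)
    Filter.univ_mem
    (Filter.Eventually.of_forall fun S => (hD.mul (continuous_phiR S)).aestronglyMeasurable)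
    ((hD.mul (continuous_phiR R)).integrableOn_box _)
    (hD.measurable.indicator (measurableSet_OR R)).aestronglyMeasurable
    (Filter.Eventually.of_forall fun x => ?_) (hD.abs.integrableOn_box _) ?_
  · rw [hmain.2.deriv, setIntegral_indicator (measurableSet_OR R)]
    congr 2
    refine Set.inter_eq_right.2 ((OR_subset_box R).trans fun x hx => ?_)
    have h := mem_box.1 hx
    exact mem_box.2 ⟨h.1.trans (by linarith), h.2.1.trans (by linarith), h.2.2⟩
  · refine LipschitzOnWith.of_dist_le_mul fun S _ T _ => ?_
    rw [Real.dist_eq, Real.dist_eq, ← mul_sub, abs_mul]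
    simp only [Real.coe_nnabs, abs_abs]
    exact mul_le_mul_of_nonneg_left (abs_phiR_sub_le S T x) (abs_nonneg _)
  · rw [ae_restrict_iff' (measurableSet_box _)]
    have n1 : ∀ᵐ x : V3, nr x ≠ R - 1 := by
      rw [ae_iff]; simpa using volume_nr_eq (R - 1)
    have n2 : ∀ᵐ x : V3, nr x ≠ R := by
      rw [ae_iff]; simpa using volume_nr_eq R
    filter_upwards [n1, n2] with x h1 h2 hx
    have h := ((hasDerivAt_phiR h1 h2).resolve_right (not_not.2 (box_subset_slab _ hx))).const_mul
      (D x)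
    convert! h using 1
    by_cases hm : x ∈ OR R <;> simp [hm]

/-! ### A smooth cut-off function -/

theorem deriv_eq_zero_of_const_outside {f : ℝ → ℝ} {c d : ℝ} (h0 : ∀ t < 0, f t = c)
    (h1 : ∀ t, 1 < t → f t = d) {t : ℝ} (ht : t ∉ Set.Icc (0:ℝ) 1) : deriv f t = 0 := by
  rw [Set.mem_Icc, not_and_or, not_le, not_le] at ht
  rcases ht with ht | ht
  · have : f =ᶠ[nhds t] fun _ => c := by
      filter_upwards [gt_mem_nhds ht] with s hs using h0 s hs
    rw [this.deriv_eq, deriv_const]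
  · have : f =ᶠ[nhds t] fun _ => d := by
      filter_upwards [lt_mem_nhds ht] with s hs using h1 s hs
    rw [this.deriv_eq, deriv_const]

theorem exists_bound_of_eq_zero_outside {f : ℝ → ℝ} (hf : Continuous f)
    (h : ∀ t ∉ Set.Icc (0:ℝ) 1, f t = 0) : ∃ K, ∀ t, |f t| ≤ K := by
  obtain ⟨K, hK⟩ := (isCompact_Icc (a := (0:ℝ)) (b := 1)).exists_bound_of_continuousOn
    hf.continuousOn
  refine ⟨max K 0, fun t => ?_⟩
  by_cases ht : t ∈ Set.Icc (0:ℝ) 1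
  · exact (hK t ht).trans (le_max_left _ _)
  · simp [h t ht]

/-- The first derivative of the smooth transition function. -/
def trans1 : ℝ → ℝ := deriv Real.smoothTransition

/-- The second derivative of the smooth transition function. -/
def trans2 : ℝ → ℝ := deriv trans1

theorem contDiff_smoothTransition : ContDiff ℝ (⊤ : ℕ∞) Real.smoothTransition :=
  Real.smoothTransition.contDiff

theorem contDiff_trans1 : ContDiff ℝ (⊤ : ℕ∞) trans1 :=
  (contDiff_infty_iff_deriv.1 contDiff_smoothTransition).2

theorem contDiff_trans2 : ContDiff ℝ (⊤ : ℕ∞) trans2 :=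
  (contDiff_infty_iff_deriv.1 contDiff_trans1).2

theorem trans1_eq_zero {t : ℝ} (ht : t ∉ Set.Icc (0:ℝ) 1) : trans1 t = 0 :=
  deriv_eq_zero_of_const_outside (fun _ h => Real.smoothTransition.zero_of_nonpos h.le)
    (fun _ h => Real.smoothTransition.one_of_one_le h.le) ht

theorem trans2_eq_zero {t : ℝ} (ht : t ∉ Set.Icc (0:ℝ) 1) : trans2 t = 0 :=
  deriv_eq_zero_of_const_outside (c := 0) (d := 0)
    (fun _ h => trans1_eq_zero fun h' => absurd h'.1 (not_le.2 h))
    (fun _ h => trans1_eq_zero fun h' => absurd h'.2 (not_le.2 h)) ht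

/-- The argument of the smooth cut-off function. -/
def profile (R : ℝ) (x : V3) : ℝ := R - (x 0 * x 0 + x 1 * x 1) * R⁻¹

/-- A smooth cut-off function, equal to `1` for `|x'| ≤ R - 1` and to `0` for `|x'| ≥ R`. -/
def cutoff (R : ℝ) (x : V3) : ℝ := Real.smoothTransition (profile R x)

/-- Coordinates of the horizontal part of `x`. -/
def hor (x : V3) (i : Fin 3) : ℝ := if i = 2 then 0 else x i

theorem contDiff_coord (i : Fin 3) : ContDiff ℝ (⊤ : ℕ∞) fun x : V3 => x i :=
  contDiff_apply ℝ ℝ i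

theorem contDiff_profile (R : ℝ) : ContDiff ℝ (⊤ : ℕ∞) (profile R) := by
  unfold profile
  fun_prop

theorem contDiff_cutoff (R : ℝ) : ContDiff ℝ (⊤ : ℕ∞) (cutoff R) :=
  contDiff_smoothTransition.comp (contDiff_profile R)

theorem contDiff_hor (i : Fin 3) : ContDiff ℝ (⊤ : ℕ∞) fun x => hor x i := by
  unfold hor
  split_ifs
  · exact contDiff_const
  · exact contDiff_coord i

theorem profile_eq (R : ℝ) (x : V3) : profile R x = R - nr x ^ 2 / R := by
  rw [profile, sq_nr]
  ring

theorem pd_profile (R : ℝ) (i : Fin 3) (x : V3) :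
    pd i (profile R) x = -(2 * R⁻¹) * hor x i := by
  have h0 := contDiff_coord 0
  have h1 := contDiff_coord 1
  have hs : ContDiff ℝ (⊤ : ℕ∞) fun x : V3 => x 0 * x 0 + x 1 * x 1 := (h0.mul h0).add (h1.mul h1)
  unfold profile
  rw [pd_sub contDiff_const (hs.mul contDiff_const), pd_mul hs contDiff_const,
    pd_add (h0.mul h0) (h1.mul h1), pd_mul h0 h0, pd_mul h1 h1]
  simp only [pd_const, pd_coord, hor]
  fin_cases i <;> simp <;> ring

theorem pd_cutoff (R : ℝ) (i : Fin 3) (x : V3) :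
    pd i (cutoff R) x = trans1 (profile R x) * (-(2 * R⁻¹) * hor x i) := by
  unfold cutoff
  rw [pd_comp (contDiff_smoothTransition.differentiable (by simp)) (contDiff_profile R),
    pd_profile]
  rfl

theorem pd_hor (i j : Fin 3) (x : V3) :
    pd j (fun y => hor y i) x = if j = i ∧ i ≠ 2 then 1 else 0 := by
  unfold hor
  by_cases h : i = 2
  · simp [h, pd_const]
  · simp [h, pd_coord]

theorem pd_pd_cutoff (R : ℝ) (i j : Fin 3) (x : V3) :
    pd j (pd i (cutoff R)) x =
      trans2 (profile R x) * (-(2 * R⁻¹) * hor x j) * (-(2 * R⁻¹) * hor x i)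
      + trans1 (profile R x) * (-(2 * R⁻¹) * if j = i ∧ i ≠ 2 then 1 else 0) := by
  rw [show pd i (cutoff R) = _ from funext (pd_cutoff R i),
    pd_mul (f := fun y => trans1 (profile R y)) (contDiff_trans1.comp (contDiff_profile R))
      (contDiff_const.mul (contDiff_hor i)),
    pd_comp (contDiff_trans1.differentiable (by simp)) (contDiff_profile R),
    pd_mul contDiff_const (contDiff_hor i), pd_profile, pd_const, pd_hor, zero_mul, zero_add]
  rfl

theorem profile_notMem {R : ℝ} (hR : 2 ≤ R) {x : V3} (hx : ¬ (R - 1 ≤ nr x ∧ nr x ≤ R)) :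
    profile R x ∉ Set.Icc (0:ℝ) 1 := by
  have hR0 : 0 < R := by linarith
  have hn := nr_nonneg x
  rw [profile_eq]
  rintro ⟨h1, h2⟩
  apply hx
  have e : nr x ^ 2 / R * R = nr x ^ 2 := by field_simp
  constructor
  · by_contra! h
    nlinarith
  · by_contra! h
    nlinarith

theorem pd_cutoff_eq_zero {R : ℝ} (hR : 2 ≤ R) (i : Fin 3) {x : V3}
    (hx : ¬ (R - 1 ≤ nr x ∧ nr x ≤ R)) : pd i (cutoff R) x = 0 := by
  rw [pd_cutoff, trans1_eq_zero (profile_notMem hR hx), zero_mul]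

theorem pd_pd_cutoff_eq_zero {R : ℝ} (hR : 2 ≤ R) (i j : Fin 3) {x : V3}
    (hx : ¬ (R - 1 ≤ nr x ∧ nr x ≤ R)) : pd j (pd i (cutoff R)) x = 0 := by
  rw [pd_pd_cutoff, trans1_eq_zero (profile_notMem hR hx), trans2_eq_zero (profile_notMem hR hx)]
  simp

theorem cutoff_of_ge {R : ℝ} (hR : 0 < R) {x : V3} (hx : R ≤ nr x) : cutoff R x = 0 := by
  refine Real.smoothTransition.zero_of_nonpos ?_
  rw [profile_eq, sub_nonpos, le_div_iff₀ hR]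
  nlinarith

theorem cutoff_of_le {R : ℝ} (hR : 2 ≤ R) {x : V3} (hx : nr x ≤ R - 1) : cutoff R x = 1 := by
  refine Real.smoothTransition.one_of_one_le ?_
  have hR0 : 0 < R := by linarith
  rw [profile_eq, le_sub_comm, div_le_iff₀ hR0]
  nlinarith [nr_nonneg x]

theorem cutoff_nonneg (R : ℝ) (x : V3) : 0 ≤ cutoff R x := Real.smoothTransition.nonneg _

theorem cutoff_shift (R : ℝ) (x : V3) : cutoff R (x + e3) = cutoff R x := by
  simp [cutoff, profile]

theorem phiR_le_cutoff_add {R : ℝ} (hR : 2 ≤ R) (x : V3) (hx : x ∈ slab) :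
    phiR R x ≤ cutoff R x + (OR R).indicator 1 x := by
  have h1 : phiR R x ≤ 1 := min_le_left _ _
  have hc := cutoff_nonneg R x
  by_cases hm : x ∈ OR R
  · simp [hm]; linarith
  · simp only [hm, not_false_eq_true, Set.indicator_of_notMem, add_zero]
    rcases le_or_gt (nr x) (R - 1) with h | h
    · rw [cutoff_of_le hR h]; exact h1
    · have h' : R < nr x := by
        by_contra! h'
        exact hm ⟨hx, h.le, h'⟩
      rw [phiR_of_ge h'.le]; exact hc

theorem abs_hor_le (x : V3) (i : Fin 3) : |hor x i| ≤ nr x := by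
  unfold hor
  fin_cases i
  · simpa using (abs_le_nr x).1
  · simpa using (abs_le_nr x).2
  · simpa using nr_nonneg x

/-- The first and second derivatives of the cut-off functions are bounded uniformly in `R`. -/
theorem exists_cutoff_bound : ∃ K ≥ (0:ℝ), ∀ R ≥ (2:ℝ), ∀ (i j : Fin 3) (x : V3),
    |pd i (cutoff R) x| ≤ K ∧ |pd j (pd i (cutoff R)) x| ≤ K := by
  obtain ⟨K1, hK1⟩ := exists_bound_of_eq_zero_outside contDiff_trans1.continuous
    fun t => trans1_eq_zero
  obtain ⟨K2, hK2⟩ := exists_bound_of_eq_zero_outside contDiff_trans2.continuous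
    fun t => trans2_eq_zero
  have h1 : 0 ≤ K1 := (abs_nonneg _).trans (hK1 0)
  have h2 : 0 ≤ K2 := (abs_nonneg _).trans (hK2 0)
  refine ⟨2 * K1 + 4 * K2, by positivity, fun R hR i j x => ?_⟩
  by_cases hx : R - 1 ≤ nr x ∧ nr x ≤ R
  · have hR0 : 0 < R := by linarith
    have hl : ∀ i, |-(2 * R⁻¹) * hor x i| ≤ 2 := by
      intro i
      rw [abs_mul, abs_neg, abs_of_pos (by positivity)]
      have := (abs_hor_le x i).trans hx.2
      calc 2 * R⁻¹ * |hor x i| ≤ 2 * R⁻¹ * R := by gcongr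
        _ = 2 := by field_simp
    have hd : |-(2 * R⁻¹) * if j = i ∧ i ≠ 2 then (1:ℝ) else 0| ≤ 2 := by
      have : R⁻¹ ≤ 1 := inv_le_one_of_one_le₀ (by linarith)
      have : 0 < R⁻¹ := by positivity
      rw [abs_mul, abs_neg, abs_of_pos (by positivity)]
      (split_ifs <;> simp); linarith
    constructor
    · rw [pd_cutoff, abs_mul]
      calc _ ≤ K1 * 2 := by gcongr; exacts [hK1 _, hl i]
        _ ≤ _ := by linarith
    · rw [pd_pd_cutoff]
      refine (abs_add_le _ _).trans ?_
      rw [abs_mul (trans2 _ * _), abs_mul (trans2 _), abs_mul (trans1 _)]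
      calc _ ≤ K2 * 2 * 2 + K1 * 2 := by gcongr; exacts [hK2 _, hl j, hl i, hK1 _]
        _ ≤ _ := by linarith
  · rw [pd_cutoff_eq_zero hR i hx, pd_pd_cutoff_eq_zero hR i j hx, abs_zero]
    constructor <;> positivity

/-! ### The energy flux -/

theorem pd_sum {f : Fin 3 → V3 → ℝ} (hf : ∀ j, ContDiff ℝ (⊤ : ℕ∞) (f j)) (i : Fin 3) (x : V3) :
    pd i (fun y => ∑ j, f j y) x = ∑ j, pd i (f j) x := by
  unfold pd
  rw [fderiv_fun_sum fun j _ => (hf j).differentiable_top x]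
  simp

theorem pd_sum_mul {f g : Fin 3 → V3 → ℝ} (hf : ∀ j, ContDiff ℝ (⊤ : ℕ∞) (f j))
    (hg : ∀ j, ContDiff ℝ (⊤ : ℕ∞) (g j)) (i : Fin 3) (x : V3) :
    pd i (fun y => ∑ j, f j y * g j y) x = ∑ j, (pd i (f j) x * g j x + f j x * pd i (g j) x) := by
  rw [pd_sum fun j => (hf j).mul (hg j)]
  exact Finset.sum_congr rfl fun j _ => pd_mul (hf j) (hg j) i x

theorem contDiff_sum_mul {f g : Fin 3 → V3 → ℝ} (hf : ∀ j, ContDiff ℝ (⊤ : ℕ∞) (f j))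
    (hg : ∀ j, ContDiff ℝ (⊤ : ℕ∞) (g j)) : ContDiff ℝ (⊤ : ℕ∞) fun y => ∑ j, f j y * g j y :=
  ContDiff.sum fun j _ => (hf j).mul (hg j)

theorem contDiff_curl {v : V3 → V3} (hv : ∀ j, ContDiff ℝ (⊤ : ℕ∞) fun x => v x j) (i : Fin 3) :
    ContDiff ℝ (⊤ : ℕ∞) fun x => curl v x i := by
  unfold curl
  fin_cases i
  · exact ((hv 2).pd 1).sub ((hv 1).pd 2)
  · exact ((hv 0).pd 2).sub ((hv 2).pd 0)
  · exact ((hv 1).pd 0).sub ((hv 0).pd 1)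

theorem contDiff_cross3 {v w : V3 → V3} (hv : ∀ j, ContDiff ℝ (⊤ : ℕ∞) fun x => v x j)
    (hw : ∀ j, ContDiff ℝ (⊤ : ℕ∞) fun x => w x j) (i : Fin 3) :
    ContDiff ℝ (⊤ : ℕ∞) fun x => cross3 (v x) (w x) i := by
  unfold cross3
  fin_cases i
  · exact ((hv 1).mul (hw 2)).sub ((hv 2).mul (hw 1))
  · exact ((hv 2).mul (hw 0)).sub ((hv 0).mul (hw 2))
  · exact ((hv 0).mul (hw 1)).sub ((hv 1).mul (hw 0))

theorem div_cross3 {v w : V3 → V3} (hv : ∀ j, ContDiff ℝ (⊤ : ℕ∞) fun x => v x j)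
    (hw : ∀ j, ContDiff ℝ (⊤ : ℕ∞) fun x => w x j) (x : V3) :
    ∑ i, pd i (fun y => cross3 (v y) (w y) i) x
      = ∑ i, w x i * curl v x i - ∑ i, v x i * curl w x i := by
  simp only [Fin.sum_univ_three, cross3, curl, Matrix.cons_val]
  rw [pd_sub ((hv 1).mul (hw 2)) ((hv 2).mul (hw 1)),
    pd_sub ((hv 2).mul (hw 0)) ((hv 0).mul (hw 2)),
    pd_sub ((hv 0).mul (hw 1)) ((hv 1).mul (hw 0)), pd_mul (hv 1) (hw 2), pd_mul (hv 2) (hw 1),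
    pd_mul (hv 2) (hw 0), pd_mul (hv 0) (hw 2), pd_mul (hv 0) (hw 1), pd_mul (hv 1) (hw 0)]
  ring

theorem div_smul {s : V3 → ℝ} {v : V3 → V3} (hs : ContDiff ℝ (⊤ : ℕ∞) s)
    (hv : ∀ j, ContDiff ℝ (⊤ : ℕ∞) fun x => v x j) (x : V3) :
    ∑ i, pd i (fun y => s y * v y i) x
      = ∑ i, pd i s x * v x i + s x * ∑ i, pd i (fun y => v y i) x := by
  simp only [pd_mul hs (hv _), Finset.sum_add_distrib, Finset.mul_sum]

theorem curl_shift {v : V3 → V3} (hv : ∀ x, v (x + e3) = v x) (x : V3) :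
    curl v (x + e3) = curl v x := by
  have h : ∀ i j, pd i (fun y => v y j) (x + e3) = pd i (fun y => v y j) x := fun i j =>
    pd_periodic (fun y => by rw [hv]) i x
  simp only [curl, h]

/-- The viscous part of the energy flux. -/
def viscousFlux (u : V3 → V3) (x : V3) (i : Fin 3) : ℝ := ∑ j, u x j * pd i (fun y => u y j) x

/-- The Hall part of the energy flux. -/
def hallFlux (b : V3 → V3) (x : V3) : V3 := cross3 (cross3 (curl b x) (b x)) (b x)

/-- The sum of the kinetic and magnetic energy densities. -/
def energyDensity (u b : V3 → V3) (x : V3) : ℝ :=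
  2⁻¹ * (∑ j, u x j * u x j) + 2⁻¹ * (∑ j, b x j * b x j)

/-- The Dirichlet energy density of a pair of vector fields. -/
def dirichletDensity (u b : V3 → V3) (x : V3) : ℝ := gradSq u x + gradSq b x

/-- The energy flux, whose divergence is the Dirichlet energy density. -/
def energyFlux (δ : ℝ) (u b : V3 → V3) (p : V3 → ℝ) (x : V3) : V3 := fun i =>
  viscousFlux u x i + viscousFlux b x i + δ * hallFlux b x i
    - (energyDensity u b x + p x) * u x i + (∑ j, u x j * b x j) * b x i

/-- Smooth solutions with vertically periodic velocity and magnetic field bounded by `M`. -/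
structure PeriodicSolution (δ M : ℝ) (u b : V3 → V3) (p : V3 → ℝ) : Prop where
  sol : IsMHD δ u b p
  nonneg : 0 ≤ δ
  le_one : δ ≤ 1
  smooth_u : ∀ i, ContDiff ℝ (⊤ : ℕ∞) fun x => u x i
  smooth_b : ∀ i, ContDiff ℝ (⊤ : ℕ∞) fun x => b x i
  smooth_p : ContDiff ℝ (⊤ : ℕ∞) p
  bound_u : ∀ x i, |u x i| ≤ M
  bound_b : ∀ x i, |b x i| ≤ M
  shift_u : ∀ x, u (x + e3) = u x
  shift_b : ∀ x, b (x + e3) = b x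

theorem contDiff_viscousFlux {u : V3 → V3} (hu : ∀ i, ContDiff ℝ (⊤ : ℕ∞) fun x => u x i)
    (i : Fin 3) : ContDiff ℝ (⊤ : ℕ∞) fun x => viscousFlux u x i :=
  contDiff_sum_mul hu fun j => (hu j).pd i

theorem div_viscousFlux {u : V3 → V3} (hu : ∀ i, ContDiff ℝ (⊤ : ℕ∞) fun x => u x i) (x : V3) :
    ∑ i, pd i (fun y => viscousFlux u y i) x
      = gradSq u x + ∑ j, u x j * lap (fun y => u y j) x := by
  unfold viscousFlux
  simp only [pd_sum_mul hu fun j => (hu j).pd _]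
  simp only [gradSq, lap, Fin.sum_univ_three]
  ring

theorem contDiff_energyDensity {u b : V3 → V3} (hu : ∀ i, ContDiff ℝ (⊤ : ℕ∞) fun x => u x i)
    (hb : ∀ i, ContDiff ℝ (⊤ : ℕ∞) fun x => b x i) : ContDiff ℝ (⊤ : ℕ∞) (energyDensity u b) :=
  (contDiff_const.mul (contDiff_sum_mul hu hu)).add (contDiff_const.mul (contDiff_sum_mul hb hb))

theorem pd_energyDensity {u b : V3 → V3} (hu : ∀ i, ContDiff ℝ (⊤ : ℕ∞) fun x => u x i)
    (hb : ∀ i, ContDiff ℝ (⊤ : ℕ∞) fun x => b x i) (i : Fin 3) (x : V3) :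
    pd i (energyDensity u b) x = ∑ j, (u x j * pd i (fun y => u y j) x
      + b x j * pd i (fun y => b y j) x) := by
  unfold energyDensity
  rw [pd_add (contDiff_const.mul (contDiff_sum_mul hu hu))
    (contDiff_const.mul (contDiff_sum_mul hb hb)), pd_mul contDiff_const (contDiff_sum_mul hu hu),
    pd_mul contDiff_const (contDiff_sum_mul hb hb), pd_sum_mul hu hu, pd_sum_mul hb hb, pd_const]
  simp only [Fin.sum_univ_three]
  ring

theorem contDiff_hallFlux {b : V3 → V3} (hb : ∀ i, ContDiff ℝ (⊤ : ℕ∞) fun x => b x i)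
    (i : Fin 3) : ContDiff ℝ (⊤ : ℕ∞) fun x => hallFlux b x i :=
  contDiff_cross3 (contDiff_cross3 (contDiff_curl hb) hb) hb i

theorem div_hallFlux {b : V3 → V3} (hb : ∀ i, ContDiff ℝ (⊤ : ℕ∞) fun x => b x i) (x : V3) :
    ∑ i, pd i (fun y => hallFlux b y i) x
      = ∑ i, b x i * curl (fun y => cross3 (curl b y) (b y)) x i := by
  unfold hallFlux
  rw [div_cross3 (contDiff_cross3 (contDiff_curl hb) hb) hb]
  have : ∑ i, cross3 (curl b x) (b x) i * curl b x i = 0 := by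
    simp only [Fin.sum_univ_three, cross3, Matrix.cons_val]
    ring
  rw [this, sub_zero]

namespace PeriodicSolution

variable {δ M : ℝ} {u b : V3 → V3} {p : V3 → ℝ}

theorem pd_u_shift (h : PeriodicSolution δ M u b p) (i j : Fin 3) (x : V3) :
    pd i (fun y => u y j) (x + e3) = pd i (fun y => u y j) x :=
  pd_periodic (fun y => by rw [h.shift_u]) i x

theorem pd_b_shift (h : PeriodicSolution δ M u b p) (i j : Fin 3) (x : V3) :
    pd i (fun y => b y j) (x + e3) = pd i (fun y => b y j) x :=
  pd_periodic (fun y => by rw [h.shift_b]) i x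

end PeriodicSolution

/-! ### The flux of a vector field through the cut-off layer -/

theorem abs_sum_mul_le {f g : Fin 3 → ℝ} {A B : ℝ} (hf : ∀ i, |f i| ≤ A) (hg : ∀ i, |g i| ≤ B) :
    |∑ i, f i * g i| ≤ 3 * (A * B) := by
  refine (Finset.abs_sum_le_sum_abs _ _).trans ?_
  refine (Finset.sum_le_sum fun i _ => ?_).trans_eq (b := ∑ _i : Fin 3, A * B) (by simp)
  rw [abs_mul]
  exact mul_le_mul (hf i) (hg i) (abs_nonneg _) ((abs_nonneg _).trans (hf i))

/-- The first and second derivatives of the cut-off at radius `R` are bounded by `K`. -/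
def CutoffBound (K R : ℝ) : Prop :=
  ∀ (i j : Fin 3) (x : V3), |pd i (cutoff R) x| ≤ K ∧ |pd j (pd i (cutoff R)) x| ≤ K

/-- The density of the flux of `v` in the direction of the gradient of the cut-off. -/
def cutoffFlux (R : ℝ) (v : V3 → V3) (x : V3) : ℝ := ∑ i, pd i (cutoff R) x * v x i

theorem contDiff_cutoffFlux {v : V3 → V3} (hv : ∀ i, ContDiff ℝ (⊤ : ℕ∞) fun x => v x i) (R : ℝ) :
    ContDiff ℝ (⊤ : ℕ∞) (cutoffFlux R v) :=
  contDiff_sum_mul (contDiff_cutoff R).pd hv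

theorem cutoffFlux_eq_zero {R : ℝ} (hR : 2 ≤ R) (v : V3 → V3) {x : V3}
    (hx : ¬(R - 1 ≤ nr x ∧ nr x ≤ R)) : cutoffFlux R v x = 0 := by
  simp only [cutoffFlux, pd_cutoff_eq_zero hR _ hx, zero_mul, Finset.sum_const_zero]

theorem abs_cutoffFlux_le {K R M : ℝ} (hK : CutoffBound K R) {v : V3 → V3} {x : V3}
    (hv : ∀ i, |v x i| ≤ M) : |cutoffFlux R v x| ≤ 3 * (K * M) :=
  abs_sum_mul_le (fun i => (hK i i x).1) hv

theorem abs_pd_cutoffFlux_le {K R M E : ℝ} (hK : CutoffBound K R) {v : V3 → V3}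
    (hv : ∀ i, ContDiff ℝ (⊤ : ℕ∞) fun x => v x i) {x : V3} {i : Fin 3} (hM : ∀ j, |v x j| ≤ M)
    (hE : ∀ j, |pd i (fun y => v y j) x| ≤ E) :
    |pd i (cutoffFlux R v) x| ≤ 3 * (K * M) + 3 * (K * E) := by
  unfold cutoffFlux
  rw [pd_sum_mul (contDiff_cutoff R).pd hv, Finset.sum_add_distrib]
  exact (abs_add_le _ _).trans (add_le_add (abs_sum_mul_le (fun j => (hK j i x).2) hM)
    (abs_sum_mul_le (fun j => (hK j i x).1) hE))

theorem pd_two_cutoff (R : ℝ) (x : V3) : pd 2 (cutoff R) x = 0 := by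
  simp [pd_cutoff, hor]

theorem pd_cutoff_of_ge {R : ℝ} (hR : 0 < R) (i : Fin 3) {x : V3} (hx : R ≤ nr x) :
    pd i (cutoff R) x = 0 := by
  have : IsLocalMin (cutoff R) x := Filter.Eventually.of_forall fun y => by
    rw [cutoff_of_ge hR hx]
    exact cutoff_nonneg R y
  simp [pd, this.fderiv_eq_zero]

theorem cutoffFlux_mean_eq_zero {v : V3 → V3} (hv : ∀ i, ContDiff ℝ (⊤ : ℕ∞) fun x => v x i)
    (hdiv : DivFree v) (hper : ∀ x, v (x + e3) = v x) (hax : AxiSym (compTheta v)) (R : ℝ)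
    (y : Fin 2 → ℝ) : ∫ z in (0:ℝ)..1, cutoffFlux R v (pt y z) = 0 := by
  have e : ∀ z, cutoffFlux R v (pt y z) = trans1 (profile R (pt y 0)) * (-(2 * R⁻¹)) *
      (y 0 * v (pt y z) 0 + y 1 * v (pt y z) 1) := by
    intro z
    have : profile R (pt y z) = profile R (pt y 0) := by simp [profile, pt]
    simp only [cutoffFlux, Fin.sum_univ_three, pd_cutoff, this, hor]
    simp [pt]
    ring
  simp only [e, intervalIntegral.integral_const_mul, radial_mean_eq_zero hv hdiv hper hax, mul_zero]

namespace PeriodicSolution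

variable {δ M : ℝ} {u b : V3 → V3} {p : V3 → ℝ}

theorem pd_p_shift (h : PeriodicSolution δ M u b p) (i : Fin 3) (x : V3) :
    pd i p (x + e3) = pd i p x := by
  have m := h.sol.1 (x + e3) i
  have m' := h.sol.1 x i
  have hl : lap (fun y => u y i) (x + e3) = lap (fun y => u y i) x :=
    Finset.sum_congr rfl fun j _ => pd_periodic (h.pd_u_shift j i) j x
  simp only [h.shift_u, h.shift_b, h.pd_u_shift, h.pd_b_shift, hl] at m
  linarith

/-- The increment of the pressure over one vertical period vanishes: otherwise it would drive a
momentum flux proportional to the volume of the cylinder, while the available flux is at most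
proportional to its lateral surface. -/
theorem shift_p (h : PeriodicSolution δ M u b p) (x : V3) : p (x + e3) = p x := by
  obtain ⟨K, hK0, hKR⟩ := exists_cutoff_bound
  have hu := h.smooth_u
  have hb := h.smooth_b
  have hp := h.smooth_p
  have hM : 0 ≤ M := (abs_nonneg _).trans (h.bound_u 0 0)
  have hshift : ContDiff ℝ (⊤ : ℕ∞) fun y => p (y + e3) := hp.comp (contDiff_id.add contDiff_const)
  set c := p (0 + e3) - p 0 with hc
  have hpc : ∀ y, p (y + e3) - p y = c := fun y =>
    eq_of_pd_eq_zero (f := fun y => p (y + e3) - p y) (hshift.sub hp) (fun i y => by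
      rw [pd_sub hshift hp, pd_shift, h.pd_p_shift, sub_self]) y 0
  have h2 : ContDiff ℝ (⊤ : ℕ∞) fun y : V3 => y 2 := contDiff_apply ℝ ℝ 2
  set q : V3 → ℝ := fun y => p y - c * y 2 with hq
  have hqs : ContDiff ℝ (⊤ : ℕ∞) q := hp.sub (contDiff_const.mul h2)
  have hq2 : ∀ y, pd 2 q y = pd 2 p y - c := fun y => by
    rw [hq, pd_sub hp (contDiff_const.mul h2), pd_mul contDiff_const h2, pd_const, pd_coord]
    simp
  have hqper : ∀ y, q (y + e3) = q y := fun y => by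
    have := hpc y
    simp only [hq, Pi.add_apply, Pi.single_eq_same]
    linarith
  have key : ∀ R : ℝ, 2 ≤ R →
      |c| * (R - 1) ^ 2 ≤ (3 * (M * K) + 6 * (K * M * M)) * (2 * Real.pi * R) := by
    intro R hR
    have hK : CutoffBound K R := hKR R hR
    have hη := contDiff_cutoff R
    have hFu := contDiff_cutoffFlux hu R
    have hFb := contDiff_cutoffFlux hb R
    set w : V3 → V3 := fun y i => pd i (fun z => u z 2) y - u y i * u y 2 + b y i * b y 2
      - if i = 2 then q y else 0 with hw
    have hwi : ∀ i, ContDiff ℝ (⊤ : ℕ∞) fun y => w y i := by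
      intro i
      refine ((((hu 2).pd i).sub ((hu i).mul (hu 2))).add ((hb i).mul (hb 2))).sub ?_
      split_ifs
      exacts [hqs, contDiff_const]
    set g : V3 → ℝ := fun y => u y 2 * (∑ i, pd i (pd i (cutoff R)) y) + u y 2 * cutoffFlux R u y
      - b y 2 * cutoffFlux R b y with hg
    have hdiv : ∀ y, ∑ i, pd i (fun z => cutoff R z * w z i - u z 2 * pd i (cutoff R) z) y
        = c * cutoff R y - g y := by
      intro y
      have e : ∀ i, pd i (fun z => w z i) y = pd i (pd i fun z => u z 2) y
          - (pd i (fun z => u z i) y * u y 2 + u y i * pd i (fun z => u z 2) y)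
          + (pd i (fun z => b z i) y * b y 2 + b y i * pd i (fun z => b z 2) y)
          - if i = 2 then pd 2 p y - c else 0 := by
        intro i
        have hlast : ContDiff ℝ (⊤ : ℕ∞) fun z : V3 => if i = 2 then q z else 0 := by
          split_ifs
          exacts [hqs, contDiff_const]
        rw [pd_sub ((((hu 2).pd i).sub ((hu i).mul (hu 2))).add ((hb i).mul (hb 2))) hlast,
          pd_add (((hu 2).pd i).sub ((hu i).mul (hu 2))) ((hb i).mul (hb 2)),
          pd_sub ((hu 2).pd i) ((hu i).mul (hu 2)), pd_mul (hu i) (hu 2), pd_mul (hb i) (hb 2)]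
        by_cases hi : i = 2
        · subst hi
          simp only [if_true, hq2]
        · simp only [hi, if_false, pd_const]
      simp only [pd_sub (hη.mul (hwi _)) ((hu 2).mul (hη.pd _)), pd_mul hη (hwi _),
        pd_mul (hu 2) (hη.pd _), e]
      have m := h.sol.1 y 2
      have du := h.sol.2.2.1 y
      have db := h.sol.2.2.2 y
      have dη := pd_two_cutoff R y
      simp only [lap, Fin.sum_univ_three] at m du db
      simp only [hg, hw, cutoffFlux, Fin.sum_univ_three, if_true, dη,
        show ¬(0 : Fin 3) = 2 by decide, show ¬(1 : Fin 3) = 2 by decide, if_false]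
      linear_combination -cutoff R y * m - cutoff R y * u y 2 * du + cutoff R y * b y 2 * db
    have hzero := integral_box_div_eq_zero (R := R) (by linarith)
      (G := fun i z => cutoff R z * w z i - u z 2 * pd i (cutoff R) z)
      (fun i => (hη.mul (hwi i)).sub ((hu 2).mul (hη.pd i)))
      (fun y => by
        simp only [hw, cutoff_shift, pd_two_cutoff, h.pd_u_shift, h.shift_u, h.shift_b, hqper])
      (fun i y hy => by
        rw [cutoff_of_ge (by linarith) hy, pd_cutoff_of_ge (by linarith) i hy]
        ring)
    have hgc : Continuous g := (((hu 2).continuous.mul (continuous_finsetSum _ fun i _ =>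
      ((hη.pd i).pd i).continuous)).add ((hu 2).continuous.mul hFu.continuous)).sub
      ((hb 2).continuous.mul hFb.continuous)
    have hηc := hη.continuous
    have hcη : Continuous fun y => c * cutoff R y := continuous_const.mul hηc
    simp only [hdiv] at hzero
    rw [integral_sub (hcη.integrableOn_box R) (hgc.integrableOn_box R),
      integral_const_mul, sub_eq_zero] at hzero
    have hgle : |∫ y in box R, g y| ≤ ∫ _y in OR R, (3 * (M * K) + 6 * (K * M * M)) := by
      refine abs_setIntegral_box_le (fun y hy => ?_) (fun y _ => ?_) continuous_const
      · simp only [hg, pd_pd_cutoff_eq_zero hR _ _ hy, cutoffFlux_eq_zero hR _ hy]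
        simp
      · have a1 : |u y 2 * ∑ i, pd i (pd i (cutoff R)) y| ≤ M * (3 * K) := by
          rw [abs_mul]
          refine mul_le_mul (h.bound_u y 2) ?_ (abs_nonneg _) hM
          simpa using abs_sum_mul_le (f := fun i => pd i (pd i (cutoff R)) y) (g := fun _ => 1)
            (B := 1) (fun i => (hK i i y).2) (by simp)
        have a2 : |u y 2 * cutoffFlux R u y| ≤ M * (3 * (K * M)) := by
          rw [abs_mul]
          exact mul_le_mul (h.bound_u y 2) (abs_cutoffFlux_le hK (h.bound_u y)) (abs_nonneg _) hM
        have a3 : |b y 2 * cutoffFlux R b y| ≤ M * (3 * (K * M)) := by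
          rw [abs_mul]
          exact mul_le_mul (h.bound_b y 2) (abs_cutoffFlux_le hK (h.bound_b y)) (abs_nonneg _) hM
        rw [abs_le] at *
        constructor <;> linarith [a1.1, a1.2, a2.1, a2.2, a3.1, a3.2]
    have hηge : (R - 1) ^ 2 ≤ ∫ y in box R, cutoff R y := by
      refine (le_volume_cylSet (by linarith : 0 ≤ R - 1)).trans ?_
      have hsub : cylSet (R - 1) ⊆ box R := fun y hy =>
        mem_box.2 ⟨(abs_le_nr y).1.trans (by linarith [hy.2]),
          (abs_le_nr y).2.trans (by linarith [hy.2]), hy.1.1, hy.1.2⟩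
      have hmeas : MeasurableSet (cylSet (R - 1)) :=
        measurableSet_slab.inter (measurableSet_le continuous_nr.measurable measurable_const)
      calc volume.real (cylSet (R - 1)) = ∫ y in cylSet (R - 1), cutoff R y := by
            rw [setIntegral_congr_fun hmeas fun y hy => cutoff_of_le hR hy.2]
            simp
        _ ≤ ∫ y in box R, cutoff R y := setIntegral_mono_set (hηc.integrableOn_box R)
            (Filter.Eventually.of_forall (cutoff_nonneg R)) hsub.eventuallyLE
    calc |c| * (R - 1) ^ 2 ≤ |c| * ∫ y in box R, cutoff R y := by gcongr
      _ = |∫ y in box R, g y| := by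
          rw [← hzero, abs_mul, abs_of_nonneg ((sq_nonneg _).trans hηge)]
      _ ≤ (3 * (M * K) + 6 * (K * M * M)) * volume.real (OR R) := by
          refine hgle.trans_eq ?_
          simp [mul_comm]
      _ ≤ _ := by
          gcongr
          exact volume_OR (by linarith)
  have hc0 : c = 0 := by
    by_contra hne
    have hpos := abs_pos.2 hne
    set A := (3 * (M * K) + 6 * (K * M * M)) * (4 * Real.pi) with hA
    have hA0 : 0 ≤ A := by positivity
    have k := key (A / |c| + 2) (by have : 0 ≤ A / |c| := by positivity
                                    linarith)
    have e : A / |c| * |c| = A := div_mul_cancel₀ _ hpos.ne'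
    have hT : 0 ≤ A / |c| := by positivity
    set T := A / |c|
    have : (3 * (M * K) + 6 * (K * M * M)) * (2 * Real.pi * (T + 2)) ≤ A * (T + 1) := by
      have : A * (T + 1) - (3 * (M * K) + 6 * (K * M * M)) * (2 * Real.pi * (T + 2))
          = A * T / 2 := by
        rw [hA]; ring
      have : 0 ≤ A * T := by positivity
      linarith
    nlinarith
  have := hpc x
  linarith

theorem contDiff_energyFlux (h : PeriodicSolution δ M u b p) (i : Fin 3) :
    ContDiff ℝ (⊤ : ℕ∞) fun x => energyFlux δ u b p x i :=
  ((((contDiff_viscousFlux h.smooth_u i).add (contDiff_viscousFlux h.smooth_b i)).add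
    (contDiff_const.mul (contDiff_hallFlux h.smooth_b i))).sub
    (((contDiff_energyDensity h.smooth_u h.smooth_b).add h.smooth_p).mul (h.smooth_u i))).add
    ((contDiff_sum_mul h.smooth_u h.smooth_b).mul (h.smooth_b i))

theorem energyFlux_shift (h : PeriodicSolution δ M u b p) (x : V3) :
    energyFlux δ u b p (x + e3) = energyFlux δ u b p x := by
  funext i
  simp only [energyFlux, viscousFlux, hallFlux, energyDensity, curl_shift h.shift_b, h.shift_u,
    h.shift_b, h.shift_p, h.pd_u_shift, h.pd_b_shift]

theorem dirichletDensity_shift (h : PeriodicSolution δ M u b p) (x : V3) :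
    dirichletDensity u b (x + e3) = dirichletDensity u b x := by
  simp only [dirichletDensity, gradSq, h.pd_u_shift, h.pd_b_shift]

theorem continuous_dirichletDensity (h : PeriodicSolution δ M u b p) :
    Continuous (dirichletDensity u b) := by
  unfold dirichletDensity gradSq
  refine Continuous.add ?_ ?_ <;> refine continuous_finsetSum _ fun i _ =>
    continuous_finsetSum _ fun j _ => Continuous.pow ?_ 2
  · exact ((h.smooth_u j).pd i).continuous
  · exact ((h.smooth_b j).pd i).continuous

theorem div_energyFlux (h : PeriodicSolution δ M u b p) (x : V3) :
    ∑ i, pd i (fun y => energyFlux δ u b p y i) x = dirichletDensity u b x := by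
  have hu := h.smooth_u
  have hb := h.smooth_b
  have hQ : ContDiff ℝ (⊤ : ℕ∞) fun x => energyDensity u b x + p x :=
    (contDiff_energyDensity hu hb).add h.smooth_p
  have hub : ContDiff ℝ (⊤ : ℕ∞) fun x => ∑ j, u x j * b x j := contDiff_sum_mul hu hb
  have e : ∀ i, pd i (fun y => energyFlux δ u b p y i) x =
      pd i (fun y => viscousFlux u y i) x + pd i (fun y => viscousFlux b y i) x
      + δ * pd i (fun y => hallFlux b y i) x - pd i (fun y => (energyDensity u b y + p y) * u y i) x
      + pd i (fun y => (∑ j, u y j * b y j) * b y i) x := by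
    intro i
    unfold energyFlux
    have h1 := contDiff_viscousFlux hu i
    have h2 := contDiff_viscousFlux hb i
    have h3 := contDiff_hallFlux hb i
    rw [pd_add ((((h1.add h2).add (contDiff_const.mul h3))).sub (hQ.mul (hu i))) (hub.mul (hb i)),
      pd_sub ((h1.add h2).add (contDiff_const.mul h3)) (hQ.mul (hu i)),
      pd_add (h1.add h2) (contDiff_const.mul h3), pd_add h1 h2, pd_mul contDiff_const h3, pd_const]
    ring
  simp only [e, Finset.sum_add_distrib, Finset.sum_sub_distrib, ← Finset.mul_sum]
  rw [div_viscousFlux hu, div_viscousFlux hb, div_hallFlux hb, div_smul hQ hu, div_smul hub hb,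
    h.sol.2.2.1 x, h.sol.2.2.2 x]
  simp only [pd_add (contDiff_energyDensity hu hb) h.smooth_p, pd_energyDensity hu hb,
    pd_sum_mul hu hb, dirichletDensity]
  have m := h.sol.1 x
  have n := h.sol.2.1 x
  have m0 := m 0
  have m1 := m 1
  have m2 := m 2
  have n0 := n 0
  have n1 := n 1
  have n2 := n 2
  simp only [Fin.sum_univ_three] at m0 m1 m2 n0 n1 n2 ⊢
  linear_combination -(u x 0 * m0 + u x 1 * m1 + u x 2 * m2 + b x 0 * n0 + b x 1 * n1 + b x 2 * n2)

theorem integral_cutoff_mul_dirichletDensity (h : PeriodicSolution δ M u b p) {R : ℝ}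
    (hR : 0 < R) : ∫ x in box R, cutoff R x * dirichletDensity u b x
      = - ∫ x in box R, ∑ i, pd i (cutoff R) x * energyFlux δ u b p x i := by
  have hη := contDiff_cutoff R
  have key := integral_box_div_eq_zero hR (G := fun i x => cutoff R x * energyFlux δ u b p x i)
    (fun i => hη.mul (h.contDiff_energyFlux i))
    (fun x => by simp only [cutoff_shift, h.energyFlux_shift])
    (fun i x hx => by simp only [cutoff_of_ge hR hx, zero_mul])
  simp only [div_smul hη h.contDiff_energyFlux, h.div_energyFlux] at key
  rw [integral_add] at key
  · linarith
  · exact (contDiff_sum_mul hη.pd h.contDiff_energyFlux).continuous.integrableOn_box R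
  · exact (hη.continuous.mul h.continuous_dirichletDensity).integrableOn_box R

end PeriodicSolution

/-! ### Energy estimates in the cut-off layer -/

theorem abs_integral_mul_le_mul_OR {R A C t : ℝ} {F g G : V3 → ℝ}
    (hsupp : ∀ x, ¬(R - 1 ≤ nr x ∧ nr x ≤ R) → F x = 0) (hA : ∀ x, |F x| ≤ A)
    (hG : Continuous G) (hper : ∀ x, G (x + e3) = G x) (hgG : ∀ x, |g x| ≤ C * G x) :
    |∫ x in box R, F x * g (x + t • e3)| ≤ A * (C * ∫ x in OR R, G x) := by
  have hGt : Continuous fun x => A * (C * G (x + t • e3)) := by fun_prop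
  refine (abs_setIntegral_box_le (fun x hx => by rw [hsupp x hx, zero_mul]) (fun x _ => ?_)
    hGt).trans_eq ?_
  · rw [abs_mul]
    exact mul_le_mul (hA x) (hgG _) (abs_nonneg _) ((abs_nonneg _).trans (hA x))
  · rw [integral_const_mul, integral_const_mul, setIntegral_OR_shift hG hper]

theorem sq_pd_le_gradSq (u : V3 → V3) (i j : Fin 3) (x : V3) :
    pd i (fun y => u y j) x ^ 2 ≤ gradSq u x :=
  (Finset.single_le_sum (f := fun j => pd i (fun y => u y j) x ^ 2)
    (fun _ _ => sq_nonneg _) (Finset.mem_univ j)).trans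
  (Finset.single_le_sum (f := fun i => ∑ j, pd i (fun y => u y j) x ^ 2)
    (fun _ _ => Finset.sum_nonneg fun _ _ => sq_nonneg _) (Finset.mem_univ i))

theorem gradSq_nonneg (u : V3 → V3) (x : V3) : 0 ≤ gradSq u x :=
  Finset.sum_nonneg fun _ _ => Finset.sum_nonneg fun _ _ => sq_nonneg _

theorem dirichletDensity_nonneg (u b : V3 → V3) (x : V3) : 0 ≤ dirichletDensity u b x :=
  add_nonneg (gradSq_nonneg u x) (gradSq_nonneg b x)

theorem abs_pd_u_le (u b : V3 → V3) (x : V3) (i j : Fin 3) :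
    |pd i (fun y => u y j) x| ≤ √(dirichletDensity u b x) :=
  Real.abs_le_sqrt ((sq_pd_le_gradSq u i j x).trans (le_add_of_nonneg_right (gradSq_nonneg b x)))

theorem abs_pd_b_le (u b : V3 → V3) (x : V3) (i j : Fin 3) :
    |pd i (fun y => b y j) x| ≤ √(dirichletDensity u b x) :=
  Real.abs_le_sqrt ((sq_pd_le_gradSq b i j x).trans (le_add_of_nonneg_left (gradSq_nonneg u x)))

theorem abs_cross3_le {v w : V3} {A B : ℝ} (hv : ∀ i, |v i| ≤ A) (hw : ∀ i, |w i| ≤ B)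
    (i : Fin 3) : |cross3 v w i| ≤ 2 * (A * B) := by
  have h : ∀ j k l m, |v j * w k - v l * w m| ≤ 2 * (A * B) := by
    intro j k l m
    refine (abs_sub _ _).trans ?_
    have : ∀ j k, |v j * w k| ≤ A * B := fun j k => by
      rw [abs_mul]
      exact mul_le_mul (hv j) (hw k) (abs_nonneg _) ((abs_nonneg _).trans (hv j))
    linarith [this j k, this l m]
  fin_cases i
  exacts [h 1 2 2 1, h 2 0 0 2, h 0 1 1 0]

theorem abs_curl_le {v : V3 → V3} {x : V3} {E : ℝ} (hv : ∀ i j, |pd i (fun y => v y j) x| ≤ E)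
    (i : Fin 3) : |curl v x i| ≤ 2 * E := by
  have h : ∀ j k l m, |pd j (fun y => v y k) x - pd l (fun y => v y m) x| ≤ 2 * E := by
    intro j k l m
    refine (abs_sub _ _).trans ?_
    linarith [hv j k, hv l m]
  fin_cases i
  exacts [h 1 2 2 1, h 2 0 0 2, h 0 1 1 0]

theorem abs_pd_sum_mul_le {M : ℝ} {v w : V3 → V3}
    (hv : ∀ i, ContDiff ℝ (⊤ : ℕ∞) fun x => v x i) (hw : ∀ i, ContDiff ℝ (⊤ : ℕ∞) fun x => w x i)
    {x : V3} {E : ℝ} (hvM : ∀ i, |v x i| ≤ M) (hwM : ∀ i, |w x i| ≤ M) (i : Fin 3)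
    (hvE : ∀ j, |pd i (fun y => v y j) x| ≤ E) (hwE : ∀ j, |pd i (fun y => w y j) x| ≤ E) :
    |pd i (fun y => ∑ j, v y j * w y j) x| ≤ 6 * M * E := by
  rw [pd_sum_mul hv hw, Finset.sum_add_distrib]
  have h1 := abs_sum_mul_le hvE hwM
  have h2 := abs_sum_mul_le hvM hwE
  have := abs_add_le (∑ j, pd i (fun y => v y j) x * w x j) (∑ j, v x j * pd i (fun y => w y j) x)
  linarith

theorem cutoffFlux_shift (R : ℝ) {v : V3 → V3} (hv : ∀ x, v (x + e3) = v x) (x : V3) :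
    cutoffFlux R v (x + e3) = cutoffFlux R v x := by
  simp only [cutoffFlux, hv, pd_periodic (cutoff_shift R)]

theorem cutoffFlux_of_ge {R : ℝ} (hR : 0 < R) (v : V3 → V3) {x : V3} (hx : R ≤ nr x) :
    cutoffFlux R v x = 0 := by
  simp only [cutoffFlux, pd_cutoff_of_ge hR _ hx, zero_mul, Finset.sum_const_zero]

theorem pd_cutoffFlux_eq_zero {R : ℝ} (hR : 2 ≤ R) {v : V3 → V3}
    (hv : ∀ i, ContDiff ℝ (⊤ : ℕ∞) fun x => v x i) (i : Fin 3) {x : V3}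
    (hx : ¬(R - 1 ≤ nr x ∧ nr x ≤ R)) : pd i (cutoffFlux R v) x = 0 := by
  unfold cutoffFlux
  rw [pd_sum_mul (contDiff_cutoff R).pd hv]
  simp only [pd_cutoff_eq_zero hR _ hx, pd_pd_cutoff_eq_zero hR _ _ hx, zero_mul, add_zero,
    Finset.sum_const_zero]

namespace PeriodicSolution

variable {δ M K R : ℝ} {u b : V3 → V3} {p : V3 → ℝ}

theorem bound_nonneg (h : PeriodicSolution δ M u b p) : 0 ≤ M :=
  (abs_nonneg _).trans (h.bound_u 0 0)

theorem abs_dissipativeFlux_le (h : PeriodicSolution δ M u b p) (x : V3) (i : Fin 3) :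
    |viscousFlux u x i + viscousFlux b x i + δ * hallFlux b x i|
      ≤ (6 * M + 8 * M ^ 2) * √(dirichletDensity u b x) := by
  have h1 : |viscousFlux u x i| ≤ _ := abs_sum_mul_le (h.bound_u x) (abs_pd_u_le u b x i)
  have h2 : |viscousFlux b x i| ≤ _ := abs_sum_mul_le (h.bound_b x) (abs_pd_b_le u b x i)
  have h3 : |hallFlux b x i| ≤ _ :=
    abs_cross3_le (abs_cross3_le (abs_curl_le (abs_pd_b_le u b x)) (h.bound_b x)) (h.bound_b x) i
  have h4 : |δ * hallFlux b x i| ≤ |hallFlux b x i| := by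
    rw [abs_mul, abs_of_nonneg h.nonneg]
    exact mul_le_of_le_one_left (abs_nonneg _) h.le_one
  have := abs_add_three (viscousFlux u x i) (viscousFlux b x i) (δ * hallFlux b x i)
  linarith

theorem continuous_sqrt (h : PeriodicSolution δ M u b p) :
    Continuous fun x => √(dirichletDensity u b x) := h.continuous_dirichletDensity.sqrt

theorem sqrt_shift (h : PeriodicSolution δ M u b p) (x : V3) :
    √(dirichletDensity u b (x + e3)) = √(dirichletDensity u b x) := by
  rw [h.dirichletDensity_shift]

theorem abs_integral_dissipativeFlux_le (h : PeriodicSolution δ M u b p) (hR : 2 ≤ R)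
    (hK : CutoffBound K R) :
    |∫ x in box R, ∑ i, pd i (cutoff R) x *
      (viscousFlux u x i + viscousFlux b x i + δ * hallFlux b x i)|
      ≤ 3 * (K * (6 * M + 8 * M ^ 2)) * ∫ x in OR R, √(dirichletDensity u b x) := by
  rw [← integral_const_mul]
  refine abs_setIntegral_box_le (fun x hx => ?_) (fun x _ => ?_)
    (continuous_const.mul h.continuous_sqrt)
  · simp only [pd_cutoff_eq_zero hR _ hx, zero_mul, Finset.sum_const_zero]
  · exact (abs_sum_mul_le (fun i => (hK i i x).1) (h.abs_dissipativeFlux_le x)).trans_eq (by ring)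

/-- Against a flux density with zero vertical means, only the vertical derivative of a transported
quantity matters. -/
theorem abs_integral_transport_le (h : PeriodicSolution δ M u b p) {F g : V3 → ℝ} {A C : ℝ}
    (hF : Continuous F) (hsupp : ∀ x, ¬(R - 1 ≤ nr x ∧ nr x ≤ R) → F x = 0)
    (hA : ∀ x, |F x| ≤ A) (hmean : ∀ y, ∫ z in (0:ℝ)..1, F (pt y z) = 0)
    (hg : ContDiff ℝ (⊤ : ℕ∞) g) (hper : ∀ x, g (x + e3) = g x)
    (hC : ∀ x, |pd 2 g x| ≤ C * √(dirichletDensity u b x)) :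
    |∫ x in box R, F x * g x| ≤ A * (C * ∫ x in OR R, √(dirichletDensity u b x)) := by
  refine abs_integral_mul_le_of_mean_zero hF hg hper hmean fun t => ?_
  exact abs_integral_mul_le_mul_OR hsupp hA h.continuous_sqrt h.sqrt_shift hC

theorem abs_pd_energyDensity_le (h : PeriodicSolution δ M u b p) (i : Fin 3) (x : V3) :
    |pd i (energyDensity u b) x| ≤ 6 * M * √(dirichletDensity u b x) := by
  rw [pd_energyDensity h.smooth_u h.smooth_b, Finset.sum_add_distrib]
  have h1 := abs_sum_mul_le (h.bound_u x) (abs_pd_u_le u b x i)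
  have h2 := abs_sum_mul_le (h.bound_b x) (abs_pd_b_le u b x i)
  have := abs_add_le (∑ j, u x j * pd i (fun y => u y j) x) (∑ j, b x j * pd i (fun y => b y j) x)
  linarith

theorem pd_two_pressure (h : PeriodicSolution δ M u b p) (x : V3) :
    pd 2 p x = lap (fun y => u y 2) x - ((∑ j, u x j * pd j (fun y => u y 2) x)
      - ∑ j, b x j * pd j (fun y => b y 2) x) := by
  linarith [h.sol.1 x 2]

theorem abs_convection_le (h : PeriodicSolution δ M u b p) (x : V3) :
    |(∑ j, u x j * pd j (fun y => u y 2) x) - ∑ j, b x j * pd j (fun y => b y 2) x|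
      ≤ 6 * M * √(dirichletDensity u b x) := by
  have h1 := abs_sum_mul_le (h.bound_u x) fun i => abs_pd_u_le u b x i 2
  have h2 := abs_sum_mul_le (h.bound_b x) fun i => abs_pd_b_le u b x i 2
  have := abs_sub (∑ j, u x j * pd j (fun y => u y 2) x) (∑ j, b x j * pd j (fun y => b y 2) x)
  linarith

theorem integral_mul_lap (h : PeriodicSolution δ M u b p) (hR : 2 ≤ R) {F : V3 → ℝ}
    (hF : ContDiff ℝ (⊤ : ℕ∞) F) (hper : ∀ x, F (x + e3) = F x)
    (hsupp : ∀ x, R ≤ nr x → F x = 0) (t : ℝ) :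
    ∫ x in box R, F x * lap (fun y => u y 2) (x + t • e3)
      = - ∫ x in box R, ∑ i, pd i F x * pd i (fun y => u y 2) (x + t • e3) := by
  have hs : ∀ i, ContDiff ℝ (⊤ : ℕ∞) fun x => pd i (fun y => u y 2) (x + t • e3) := fun i =>
    ((h.smooth_u 2).pd i).comp (contDiff_id.add contDiff_const)
  have key := integral_box_div_eq_zero (R := R) (by linarith)
    (G := fun i x => F x * pd i (fun y => u y 2) (x + t • e3)) (fun i => hF.mul (hs i))
    (fun x => by rw [hper, add_right_comm, h.pd_u_shift])
    (fun i x hx => by rw [hsupp x hx, zero_mul])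
  have e : ∀ x, ∑ i, pd i (fun x => F x * pd i (fun y => u y 2) (x + t • e3)) x =
      F x * lap (fun y => u y 2) (x + t • e3)
      + ∑ i, pd i F x * pd i (fun y => u y 2) (x + t • e3) := by
    intro x
    have := div_smul (v := fun x i => pd i (fun y => u y 2) (x + t • e3)) hF hs x
    simp only [pd_shift] at this
    rw [this, lap, add_comm]
  simp only [e] at key
  have hlap : ContDiff ℝ (⊤ : ℕ∞) fun x => lap (fun y => u y 2) (x + t • e3) := by
    exact (ContDiff.sum fun i _ => ((h.smooth_u 2).pd i).pd i).comp
      (contDiff_id.add contDiff_const)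
  rw [integral_add ((hF.mul hlap).continuous.integrableOn_box R)
    ((contDiff_sum_mul hF.pd hs).continuous.integrableOn_box R)] at key
  linarith

theorem abs_integral_cutoffFlux_mul_lap_le (h : PeriodicSolution δ M u b p) (hR : 2 ≤ R)
    (hK0 : 0 ≤ K) (hK : CutoffBound K R) (t : ℝ) :
    |∫ x in box R, cutoffFlux R u x * lap (fun y => u y 2) (x + t • e3)|
      ≤ 9 * K * M * (∫ x in OR R, √(dirichletDensity u b x))
        + 9 * K * ∫ x in OR R, dirichletDensity u b x := by
  set E : V3 → ℝ := fun x => √(dirichletDensity u b x) with hE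
  have hEc : Continuous E := h.continuous_sqrt
  have hDc := h.continuous_dirichletDensity
  have hEt : Continuous fun x => E (x + t • e3) := by fun_prop
  have hDt : Continuous fun x => dirichletDensity u b (x + t • e3) := by fun_prop
  have hsq : ∀ x, E x ^ 2 = dirichletDensity u b x := fun x =>
    Real.sq_sqrt (dirichletDensity_nonneg u b x)
  rw [h.integral_mul_lap hR (contDiff_cutoffFlux h.smooth_u R) (cutoffFlux_shift R h.shift_u)
    (fun x => cutoffFlux_of_ge (by linarith) u), abs_neg]
  refine (abs_setIntegral_box_le (g := fun x => 9 * K * M * E (x + t • e3)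
    + (9 * K / 2 * dirichletDensity u b x + 9 * K / 2 * dirichletDensity u b (x + t • e3)))
    (fun x hx => ?_) (fun x _ => ?_) (by fun_prop)).trans_eq ?_
  · simp only [pd_cutoffFlux_eq_zero hR h.smooth_u _ hx, zero_mul, Finset.sum_const_zero]
  · refine (abs_sum_mul_le (fun i => abs_pd_cutoffFlux_le hK h.smooth_u (h.bound_u x)
      (abs_pd_u_le u b x i)) (fun i => abs_pd_u_le u b (x + t • e3) i 2)).trans ?_
    change 3 * ((3 * (K * M) + 3 * (K * E x)) * E (x + t • e3)) ≤ _
    rw [← hsq, ← hsq]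
    nlinarith [mul_nonneg hK0 (sq_nonneg (E x - E (x + t • e3)))]
  · have i1 : IntegrableOn (fun x => 9 * K * M * E (x + t • e3)) (OR R) :=
      (continuous_const.mul hEt).integrableOn_OR R
    have i2 : IntegrableOn (fun x => 9 * K / 2 * dirichletDensity u b x) (OR R) :=
      (continuous_const.mul hDc).integrableOn_OR R
    have i3 : IntegrableOn (fun x => 9 * K / 2 * dirichletDensity u b (x + t • e3)) (OR R) :=
      (continuous_const.mul hDt).integrableOn_OR R
    rw [integral_add (f := fun x => 9 * K * M * E (x + t • e3)) (g := fun x =>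
      9 * K / 2 * dirichletDensity u b x + 9 * K / 2 * dirichletDensity u b (x + t • e3))
      i1 (i2.add i3), integral_add i2 i3, integral_const_mul, integral_const_mul,
      integral_const_mul, setIntegral_OR_shift hEc h.sqrt_shift,
      setIntegral_OR_shift hDc h.dirichletDensity_shift]
    ring

theorem abs_integral_pressure_le (h : PeriodicSolution δ M u b p) (hR : 2 ≤ R)
    (hK0 : 0 ≤ K) (hK : CutoffBound K R)
    (hmean : ∀ y, ∫ z in (0:ℝ)..1, cutoffFlux R u (pt y z) = 0) :
    |∫ x in box R, cutoffFlux R u x * p x|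
      ≤ (9 * K * M + 18 * K * M ^ 2) * (∫ x in OR R, √(dirichletDensity u b x))
        + 9 * K * ∫ x in OR R, dirichletDensity u b x := by
  have hF := contDiff_cutoffFlux h.smooth_u R
  refine abs_integral_mul_le_of_mean_zero hF.continuous h.smooth_p h.shift_p hmean fun t => ?_
  set N : V3 → ℝ := fun x => (∑ j, u x j * pd j (fun y => u y 2) x)
    - ∑ j, b x j * pd j (fun y => b y 2) x with hN
  have hNc : Continuous N := ((contDiff_sum_mul h.smooth_u (h.smooth_u 2).pd).sub
    (contDiff_sum_mul h.smooth_b (h.smooth_b 2).pd)).continuous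
  have hlc : Continuous (lap fun y => u y 2) :=
    continuous_finsetSum _ fun i _ => (((h.smooth_u 2).pd i).pd i).continuous
  have hNt : Continuous fun x => cutoffFlux R u x * N (x + t • e3) :=
    hF.continuous.mul (by fun_prop)
  have hlt : Continuous fun x => cutoffFlux R u x * lap (fun y => u y 2) (x + t • e3) :=
    hF.continuous.mul (by fun_prop)
  have h1 := h.abs_integral_cutoffFlux_mul_lap_le hR hK0 hK t
  have h2 := abs_integral_mul_le_mul_OR (t := t) (g := N) (fun x => cutoffFlux_eq_zero hR u)
    (fun x => abs_cutoffFlux_le hK (h.bound_u x)) h.continuous_sqrt h.sqrt_shift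
    h.abs_convection_le
  have e : ∀ x, cutoffFlux R u x * pd 2 p (x + t • e3) =
      cutoffFlux R u x * lap (fun y => u y 2) (x + t • e3) - cutoffFlux R u x * N (x + t • e3) :=
    fun x => by rw [h.pd_two_pressure, mul_sub]
  simp only [e]
  rw [integral_sub (hlt.integrableOn_box R) (hNt.integrableOn_box R)]
  refine (abs_sub _ _).trans ?_
  linarith

theorem integral_cutoff_mul_dirichletDensity_le (h : PeriodicSolution δ M u b p) (hR : 2 ≤ R)
    (hK0 : 0 ≤ K) (hK : CutoffBound K R)
    (hu : ∀ y, ∫ z in (0:ℝ)..1, cutoffFlux R u (pt y z) = 0)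
    (hb : ∀ y, ∫ z in (0:ℝ)..1, cutoffFlux R b (pt y z) = 0) :
    ∫ x in box R, cutoff R x * dirichletDensity u b x
      ≤ (27 * K * M + 78 * K * M ^ 2) * (∫ x in OR R, √(dirichletDensity u b x))
        + 9 * K * ∫ x in OR R, dirichletDensity u b x := by
  have hFu := (contDiff_cutoffFlux h.smooth_u R).continuous
  have hFb := (contDiff_cutoffFlux h.smooth_b R).continuous
  have hec := contDiff_energyDensity h.smooth_u h.smooth_b
  have hub := contDiff_sum_mul h.smooth_u h.smooth_b
  have e : ∀ x, ∑ i, pd i (cutoff R) x * energyFlux δ u b p x i =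
      (∑ i, pd i (cutoff R) x * (viscousFlux u x i + viscousFlux b x i + δ * hallFlux b x i))
      - cutoffFlux R u x * energyDensity u b x - cutoffFlux R u x * p x
      + cutoffFlux R b x * ∑ j, u x j * b x j := by
    intro x
    simp only [energyFlux, cutoffFlux, Fin.sum_univ_three]
    ring
  have c1 : Continuous fun x => ∑ i, pd i (cutoff R) x *
      (viscousFlux u x i + viscousFlux b x i + δ * hallFlux b x i) :=
    (contDiff_sum_mul (contDiff_cutoff R).pd fun i =>
      ((contDiff_viscousFlux h.smooth_u i).add (contDiff_viscousFlux h.smooth_b i)).add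
        (contDiff_const.mul (contDiff_hallFlux h.smooth_b i))).continuous
  have i1 := c1.integrableOn_box R
  have i2 : IntegrableOn (fun x => cutoffFlux R u x * energyDensity u b x) (box R) :=
    (hFu.mul hec.continuous).integrableOn_box R
  have i3 : IntegrableOn (fun x => cutoffFlux R u x * p x) (box R) :=
    (hFu.mul h.smooth_p.continuous).integrableOn_box R
  have i4 : IntegrableOn (fun x => cutoffFlux R b x * ∑ j, u x j * b x j) (box R) :=
    (hFb.mul hub.continuous).integrableOn_box R
  have i12 : IntegrableOn (fun x => (∑ i, pd i (cutoff R) x *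
      (viscousFlux u x i + viscousFlux b x i + δ * hallFlux b x i))
      - cutoffFlux R u x * energyDensity u b x) (box R) := i1.sub i2
  have i123 : IntegrableOn (fun x => (∑ i, pd i (cutoff R) x *
      (viscousFlux u x i + viscousFlux b x i + δ * hallFlux b x i))
      - cutoffFlux R u x * energyDensity u b x - cutoffFlux R u x * p x) (box R) := i12.sub i3
  rw [h.integral_cutoff_mul_dirichletDensity (by linarith)]
  simp only [e]
  rw [integral_add i123 i4, integral_sub i12 i3, integral_sub i1 i2]
  have b1 := h.abs_integral_dissipativeFlux_le hR hK
  have b2 := h.abs_integral_transport_le hFu (fun x => cutoffFlux_eq_zero hR u)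
    (fun x => abs_cutoffFlux_le hK (h.bound_u x)) hu hec
    (fun x => by simp only [energyDensity, h.shift_u, h.shift_b]) (h.abs_pd_energyDensity_le 2)
  have b3 := h.abs_integral_pressure_le hR hK0 hK hu
  have b4 := h.abs_integral_transport_le hFb (fun x => cutoffFlux_eq_zero hR b)
    (fun x => abs_cutoffFlux_le hK (h.bound_b x)) hb hub
    (fun x => by simp only [h.shift_u, h.shift_b]) fun x =>
      abs_pd_sum_mul_le h.smooth_u h.smooth_b (h.bound_u x) (h.bound_b x) 2
        (abs_pd_u_le u b x 2) (abs_pd_b_le u b x 2)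
  linarith [(abs_le.1 b1).1, (abs_le.1 b2).2, (abs_le.1 b3).2, (abs_le.1 b4).1]

theorem integral_sqrt_le (h : PeriodicSolution δ M u b p) (hR : 1 ≤ R) :
    ∫ x in OR R, √(dirichletDensity u b x)
      ≤ √(2 * Real.pi) * √R * √(∫ x in OR R, dirichletDensity u b x) := by
  have hc := h.continuous_sqrt
  set D' := ∫ x in OR R, dirichletDensity u b x with hD'
  set S := ∫ x in OR R, √(dirichletDensity u b x) with hS
  set V := volume.real (OR R)
  have hV : V ≤ 2 * Real.pi * R := volume_OR hR
  have hS0 : 0 ≤ S := integral_nonneg fun x => Real.sqrt_nonneg _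
  have quad : ∀ t : ℝ, 0 ≤ V * (t * t) + (-2 * S) * t + D' := by
    intro t
    have i1 := h.continuous_dirichletDensity.integrableOn_OR R
    have i2 : IntegrableOn (fun x => -2 * t * √(dirichletDensity u b x)) (OR R) :=
      (continuous_const.mul hc).integrableOn_OR R
    have i3 : IntegrableOn (fun _ : V3 => t * t) (OR R) := continuous_const.integrableOn_OR R
    have i12 : IntegrableOn (fun x => dirichletDensity u b x
        + -2 * t * √(dirichletDensity u b x)) (OR R) := i1.add i2
    have key : 0 ≤ ∫ x in OR R,
        (dirichletDensity u b x + -2 * t * √(dirichletDensity u b x) + t * t) := by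
      refine integral_nonneg fun x => ?_
      have := Real.sq_sqrt (dirichletDensity_nonneg u b x)
      have := sq_nonneg (√(dirichletDensity u b x) - t)
      simp only [Pi.zero_apply]
      nlinarith
    rw [integral_add i12 i3, integral_add i1 i2, integral_const_mul, setIntegral_const,
      smul_eq_mul] at key
    linarith
  have hdisc := discrim_le_zero quad
  rw [discrim] at hdisc
  have hD0 : 0 ≤ D' := integral_nonneg fun x => dirichletDensity_nonneg u b x
  have hpi := Real.pi_pos
  rw [← Real.sqrt_mul (by positivity), ← Real.sqrt_mul (by positivity)]
  refine Real.le_sqrt_of_sq_le ?_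
  nlinarith [mul_le_mul_of_nonneg_right hV hD0]

theorem integral_phiR_le (h : PeriodicSolution δ M u b p) (hR : 2 ≤ R) :
    ∫ x in slab, dirichletDensity u b x * phiR R x
      ≤ (∫ x in box R, cutoff R x * dirichletDensity u b x)
        + ∫ x in OR R, dirichletDensity u b x := by
  have hDc := h.continuous_dirichletDensity
  have hηD : Continuous fun x => cutoff R x * dirichletDensity u b x :=
    (contDiff_cutoff R).continuous.mul hDc
  have hφD : Continuous fun x => dirichletDensity u b x * phiR R x :=
    hDc.mul (continuous_phiR R)
  have hind : IntegrableOn ((OR R).indicator (dirichletDensity u b)) (box R) :=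
    (hDc.integrableOn_box R).indicator (measurableSet_OR R)
  rw [setIntegral_slab_eq_box fun x hx => by rw [phiR_of_ge hx.le, mul_zero]]
  calc ∫ x in box R, dirichletDensity u b x * phiR R x
      ≤ ∫ x in box R, (cutoff R x * dirichletDensity u b x
        + (OR R).indicator (dirichletDensity u b) x) := by
        refine setIntegral_mono_on (hφD.integrableOn_box R) ((hηD.integrableOn_box R).add hind)
          (measurableSet_box R) fun x hx => ?_
        have h1 := mul_le_mul_of_nonneg_left (phiR_le_cutoff_add hR x (box_subset_slab R hx))
          (dirichletDensity_nonneg u b x)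
        refine h1.trans_eq ?_
        by_cases hm : x ∈ OR R <;> simp [hm] <;> ring
    _ = _ := by
        rw [integral_add (hηD.integrableOn_box R) hind, setIntegral_indicator (measurableSet_OR R),
          Set.inter_eq_self_of_subset_right (OR_subset_box R)]

end PeriodicSolution

/-- Saint-Venant differential inequality
`Y ≤ C₁ Y' + C₂ R^{1/2} (Y')^{1/2}` under axisymmetry of the swirl components. -/
theorem saint_venant_swirl (δ : ℝ) (hδ : δ ∈ Set.Icc (0:ℝ) 1)
    (u b : V3 → V3) (p : V3 → ℝ)
    (hu : ContDiff ℝ (⊤ : ℕ∞) u) (hb : ContDiff ℝ (⊤ : ℕ∞) b) (hp : ContDiff ℝ (⊤ : ℕ∞) p)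
    (hubd : Bounded3 u) (hbbd : Bounded3 b)
    (hup : PeriodicZ u) (hbp : PeriodicZ b)
    (hsol : IsMHD δ u b p)
    (haxu : AxiSym (compTheta u)) (haxb : AxiSym (compTheta b))
    (Y : ℝ → ℝ)
    (hY : ∀ R : ℝ, Y R = ∫ x in slab, (gradSq u x + gradSq b x) * phiR R x) :
    ∃ C₁ > (0:ℝ), ∃ C₂ > (0:ℝ), ∀ R ≥ (2:ℝ),
      Y R ≤ C₁ * deriv Y R + C₂ * Real.sqrt R * Real.sqrt (deriv Y R) := by
  obtain ⟨Mu, hMu⟩ := hubd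
  obtain ⟨Mb, hMb⟩ := hbbd
  have hadd : ∀ x : V3, ![x 0, x 1, x 2 + 1] = x + e3 := fun x => by
    ext i
    fin_cases i <;> simp
  have h : PeriodicSolution δ (max Mu Mb) u b p :=
    { sol := hsol
      nonneg := hδ.1
      le_one := hδ.2
      smooth_u := contDiff_pi.1 hu
      smooth_b := contDiff_pi.1 hb
      smooth_p := hp
      bound_u := fun x i => (norm_le_pi_norm (u x) i).trans ((hMu x).trans (le_max_left _ _))
      bound_b := fun x i => (norm_le_pi_norm (b x) i).trans ((hMb x).trans (le_max_right _ _))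
      shift_u := fun x => by rw [← hadd, hup]
      shift_b := fun x => by rw [← hadd, hbp] }
  set M := max Mu Mb
  have hM := h.bound_nonneg
  obtain ⟨K, hK0, hK⟩ := exists_cutoff_bound
  have hDc := h.continuous_dirichletDensity
  have hY' : Y = fun R => ∫ x in slab, dirichletDensity u b x * phiR R x := funext hY
  refine ⟨9 * K + 1, by positivity, (27 * K * M + 78 * K * M ^ 2) * √(2 * Real.pi) + 1,
    by positivity, fun R hR => ?_⟩
  have hderiv : deriv Y R = ∫ x in OR R, dirichletDensity u b x := by
    rw [hY', deriv_integral_mul_phiR hDc]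
  have hR0 : 0 ≤ R := by linarith
  have hE := h.integral_cutoff_mul_dirichletDensity_le hR hK0 (hK R hR)
    (cutoffFlux_mean_eq_zero h.smooth_u hsol.2.2.1 h.shift_u haxu R)
    (cutoffFlux_mean_eq_zero h.smooth_b hsol.2.2.2 h.shift_b haxb R)
  have hS := h.integral_sqrt_le (by linarith : 1 ≤ R)
  have hle := h.integral_phiR_le hR
  rw [hderiv, hY']
  set D' := ∫ x in OR R, dirichletDensity u b x
  set S := ∫ x in OR R, √(dirichletDensity u b x)
  have hsqrt : 0 ≤ √R * √D' := by positivity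
  have hAS : (27 * K * M + 78 * K * M ^ 2) * S
      ≤ (27 * K * M + 78 * K * M ^ 2) * (√(2 * Real.pi) * √R * √D') := by gcongr
  simp only at hle ⊢
  linarith
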